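/- arXiv:2110.14964 — 2 statements merged into one kernel-verified Lean document; each statement's English description precedes it below -/
import Mathlib

section
/- An affine MV polytope P is a top polytope (λ = λ̄ = ∅ and a_k = ā_k = 0 for all k ≥ 2) if and only if there exist t ≥ 0, integers k_1 > k_2 > ⋯ > k_t > 0 and indices i_1, …, i_t ∈ ℤ/2ℤ with i_{j+1} = i_j + 1, such that P = f_{i_1}^{k_1} f_{i_2}^{k_2} ⋯ f_{i_t}^{k_t}(P_0), where P_0 is the trivial MV polytope; that is, there are MV polytopes Q_t = P_0, Q_{t−1}, …, Q_0 = P with Q_{j−1} = f_{i_j}^{k_j}(Q_j) for each 1 ≤ j ≤ t. -/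
namespace MVPaper

/-- The lattice `L = ℤα₀ ⊕ ℤα₁`, a vector `(x, y)` standing for `xα₀ + yα₁`;
`(v, ω₀) = x` is the first coordinate and `(v, ω₁) = y` the second. -/
abbrev LatL := ℤ × ℤ

def alpha0 : LatL := (1, 0)
def alpha1 : LatL := (0, 1)
def deltaL : LatL := (1, 1)

/-- A Lusztig datum: a finitely supported sequence `(a_k)_{k≥1}` (here `a k = a_{k+1}`),
a partition `lam` (a multiset of positive integers), and a finitely supported sequence
`(a^k)_{k≥1}` (here `A k = a^{k+1}`). -/
structure LusztigDatum where
  a : ℕ →₀ ℕ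
  lam : Multiset ℕ
  A : ℕ →₀ ℕ
  lam_pos : ∀ x ∈ lam, 0 < x

namespace LusztigDatum

/-- The lower vertex `μ_k = ∑_{j=1}^k a_j (sroot + (j−1)δ)`. -/
def muLow (d : LusztigDatum) (sroot : LatL) (k : ℕ) : LatL :=
  ∑ j ∈ Finset.range k, (d.a j) • (sroot + j • deltaL)

/-- The vertex `μ_∞`. -/
def muInf (d : LusztigDatum) (sroot : LatL) : LatL :=
  d.a.sum fun j m => m • (sroot + j • deltaL)

/-- The vertex `μ^∞ = μ_∞ + |λ|δ`. -/
def muTopInf (d : LusztigDatum) (sroot : LatL) : LatL :=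
  d.muInf sroot + (d.lam.sum) • deltaL

/-- The upper vertex `μ^k = μ^∞ + ∑_{j>k} a^j (oroot + (j−1)δ)`. -/
def muHigh (d : LusztigDatum) (sroot oroot : LatL) (k : ℕ) : LatL :=
  d.muTopInf sroot + ∑ j ∈ d.A.support.filter (fun j => k ≤ j), (d.A j) • (oroot + j • deltaL)

end LusztigDatum

/-- An affine `sl₂` MV polytope: a pair of Lusztig data (right datum `R`, left datum `L`)
of the same weight, satisfying the conditions (i)–(iv) of
Baumann–Dunlap–Kamnitzer–Tingley. -/
structure MVPolytope where
  R : LusztigDatum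
  L : LusztigDatum
  closing : R.muHigh alpha1 alpha0 0 = L.muHigh alpha0 alpha1 0
  cond_low : ∀ k : ℕ, 2 ≤ k →
    (L.muLow alpha0 k - R.muLow alpha1 (k - 1)).2 ≤ 0 ∧
    (R.muLow alpha1 k - L.muLow alpha0 (k - 1)).1 ≤ 0 ∧
    ((L.muLow alpha0 k - R.muLow alpha1 (k - 1)).2 = 0 ∨
      (R.muLow alpha1 k - L.muLow alpha0 (k - 1)).1 = 0)
  cond_high : ∀ k : ℕ, 2 ≤ k →
    0 ≤ (L.muHigh alpha0 alpha1 k - R.muHigh alpha1 alpha0 (k - 1)).1 ∧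
    0 ≤ (R.muHigh alpha1 alpha0 k - L.muHigh alpha0 alpha1 (k - 1)).2 ∧
    ((L.muHigh alpha0 alpha1 k - R.muHigh alpha1 alpha0 (k - 1)).1 = 0 ∨
      (R.muHigh alpha1 alpha0 k - L.muHigh alpha0 alpha1 (k - 1)).2 = 0)
  cond_parts :
    (if (R.muInf alpha1 - L.muInf alpha0).1 * (R.muTopInf alpha1 - L.muTopInf alpha0).2
        = (R.muInf alpha1 - L.muInf alpha0).2 * (R.muTopInf alpha1 - L.muTopInf alpha0).1
     then R.lam = L.lam
     else ∃ n : ℕ,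
        (n : ℤ) = (R.muInf alpha1 - L.muInf alpha0).2 - (R.muInf alpha1 - L.muInf alpha0).1 ∧
        (R.lam = n ::ₘ L.lam ∨ L.lam = n ::ₘ R.lam))
  cond_size : ∀ x : ℕ, (x ∈ R.lam ∨ x ∈ L.lam) →
    (x : ℤ) ≤ (R.muInf alpha1 - L.muInf alpha0).2 - (R.muInf alpha1 - L.muInf alpha0).1

/-- `MVf i n P Q` says `Q = f_i^n(P)`: for `i = 1` the right datum of `Q` is that of `P`
with `a_1` increased by `n`; for `i = 0` the left datum of `Q` is that of `P` with `ā_1`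
increased by `n` (the other datum is then determined, by BDKT Theorem 3.11). -/
def MVf (i : ZMod 2) (n : ℕ) (P Q : MVPolytope) : Prop :=
  if i = 1 then
    Q.R.a = P.R.a + Finsupp.single 0 n ∧ Q.R.lam = P.R.lam ∧ Q.R.A = P.R.A
  else
    Q.L.a = P.L.a + Finsupp.single 0 n ∧ Q.L.lam = P.L.lam ∧ Q.L.A = P.L.A

/-- The trivial (highest weight) MV polytope: all data vanish. -/
def IsTrivialMV (P : MVPolytope) : Prop :=
  P.R.a = 0 ∧ P.R.lam = 0 ∧ P.R.A = 0 ∧ P.L.a = 0 ∧ P.L.lam = 0 ∧ P.L.A = 0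

/-- A top polytope: `λ = λ̄ = ∅` and `a_k = ā_k = 0` for all `k ≥ 2`. -/
def IsTopMV (P : MVPolytope) : Prop :=
  P.R.lam = 0 ∧ P.L.lam = 0 ∧ (∀ k, 1 ≤ k → P.R.a k = 0) ∧ (∀ k, 1 ≤ k → P.L.a k = 0)

/-- A δ-top polytope: `a_k = ā_k = 0` for all `k ≥ 2`. -/
def IsDeltaTopMV (P : MVPolytope) : Prop :=
  (∀ k, 1 ≤ k → P.R.a k = 0) ∧ (∀ k, 1 ≤ k → P.L.a k = 0)

/-- `P = f_{i_0}^{k_0} ⋯ f_{i_{t-1}}^{k_{t-1}}(P₀)` with `P₀` the trivial MV polytope: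
a chain `Q t = P₀, …, Q 0 = P` with `Q j = f_{i_j}^{k_j}(Q (j+1))`. -/
def FWordChain (t : ℕ) (k : ℕ → ℕ) (i : ℕ → ZMod 2) (P : MVPolytope) : Prop :=
  ∃ Q : ℕ → MVPolytope, IsTrivialMV (Q t) ∧ Q 0 = P ∧
    ∀ j, j < t → MVf (i j) (k j) (Q (j + 1)) (Q j)


/-! ### Numerical sequences -/

/-- Partial sums `∑_{j<k} j f_j`. -/
def pT (f : ℕ → ℕ) (k : ℕ) : ℤ := ∑ j ∈ Finset.range k, (f j : ℤ) * j
/-- Partial sums `∑_{j<k} (j+1) f_j`. -/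
def pS (f : ℕ → ℕ) (k : ℕ) : ℤ := ∑ j ∈ Finset.range k, (f j : ℤ) * (j + 1)

lemma pT_zero (f) : pT f 0 = 0 := by simp [pT]
lemma pS_zero (f) : pS f 0 = 0 := by simp [pS]
lemma pT_succ (f k) : pT f (k+1) = pT f k + (f k : ℤ) * k := by
  simp [pT, Finset.sum_range_succ]
lemma pS_succ (f k) : pS f (k+1) = pS f k + (f k : ℤ) * (k + 1) := by
  simp [pS, Finset.sum_range_succ]
lemma pT_congr {f g : ℕ → ℕ} {k} (h : ∀ j < k, f j = g j) : pT f k = pT g k :=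
  Finset.sum_congr rfl fun j hj => by rw [h j (Finset.mem_range.1 hj)]
lemma pS_congr {f g : ℕ → ℕ} {k} (h : ∀ j < k, f j = g j) : pS f k = pS g k :=
  Finset.sum_congr rfl fun j hj => by rw [h j (Finset.mem_range.1 hj)]
lemma pT_nonneg (f k) : 0 ≤ pT f k := Finset.sum_nonneg fun j _ => by positivity
lemma pS_mono (f) : Monotone (pS f) := monotone_nat_of_le_succ fun k => by
  rw [pS_succ]; have : 0 ≤ (f k : ℤ) * (k + 1) := by positivity
  linarith

/-- Total sums. -/
def tT (F : ℕ →₀ ℕ) : ℤ := F.sum fun j m => (m : ℤ) * j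
def tS (F : ℕ →₀ ℕ) : ℤ := F.sum fun j m => (m : ℤ) * (j + 1)

lemma tT_eq (F : ℕ →₀ ℕ) {k} (h : ∀ j, k ≤ j → F j = 0) : pT F k = tT F := by
  unfold pT tT Finsupp.sum
  symm
  apply Finset.sum_subset
  · intro j hj
    simp only [Finsupp.mem_support_iff] at hj
    rw [Finset.mem_range]
    by_contra hc
    exact hj (h j (by omega))
  · intro j _ hj
    simp only [Finsupp.mem_support_iff, not_not] at hj
    simp [hj]

lemma tS_eq (F : ℕ →₀ ℕ) {k} (h : ∀ j, k ≤ j → F j = 0) : pS F k = tS F := by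
  unfold pS tS Finsupp.sum
  symm
  apply Finset.sum_subset
  · intro j hj
    simp only [Finsupp.mem_support_iff] at hj
    rw [Finset.mem_range]
    by_contra hc
    exact hj (h j (by omega))
  · intro j _ hj
    simp only [Finsupp.mem_support_iff, not_not] at hj
    simp [hj]

lemma exists_bd (F : ℕ →₀ ℕ) : ∃ N, ∀ j, N ≤ j → F j = 0 := by
  refine ⟨F.support.sup id + 1, fun j hj => ?_⟩
  by_contra hc
  have : j ≤ F.support.sup id := Finset.le_sup (f := id) (Finsupp.mem_support_iff.2 hc)
  omega

lemma tT_nonneg (F) : 0 ≤ tT F := Finset.sum_nonneg fun j _ => by positivity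
lemma tS_eq_zero {F} (h : tS F ≤ 0) : F = 0 := by
  ext j
  by_contra hc
  have h1 : (F j : ℤ) * (j + 1) ≤ tS F :=
    Finset.single_le_sum (f := fun j => (F j : ℤ) * (j + 1)) (fun j _ => by positivity)
      (Finsupp.mem_support_iff.2 hc)
  have h2 : 0 < (F j : ℤ) * (j + 1) := by
    have : 0 < F j := Nat.pos_of_ne_zero hc
    positivity
  omega
lemma tS_sub (F) : tS F - tT F = F.sum fun _ m => (m : ℤ) := by
  unfold tS tT Finsupp.sum
  rw [← Finset.sum_sub_distrib]
  exact Finset.sum_congr rfl fun j _ => by ring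
lemma tT_le_tS (F) : tT F ≤ tS F := by
  have : 0 ≤ F.sum fun _ m => (m : ℤ) := Finset.sum_nonneg fun j _ => by positivity
  linarith [tS_sub F]
lemma eq_zero_of_tS_le_tT {F} (h : tS F ≤ tT F) : F = 0 := by
  ext j
  by_contra hc
  have h1 : (F j : ℤ) ≤ F.sum fun _ m => (m : ℤ) :=
    Finset.single_le_sum (f := fun j => (F j : ℤ)) (fun j _ => by positivity)
      (Finsupp.mem_support_iff.2 hc)
  have h2 : 0 < F j := Nat.pos_of_ne_zero hc
  have := tS_sub F
  omega
lemma tT_zero : tT 0 = 0 := by simp [tT]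
lemma tS_zero : tS 0 = 0 := by simp [tS]
lemma tT_single (r) : tT (Finsupp.single 0 r) = 0 := by simp [tT]
lemma tS_single (r) : tS (Finsupp.single 0 r) = r := by simp [tS]

def SolAt (A D : ℕ → ℕ) (k : ℕ) : Prop :=
  pT D (k+1) ≤ pS A k ∧ pT A (k+1) ≤ pS D k ∧ (pT D (k+1) = pS A k ∨ pT A (k+1) = pS D k)

def Sol (A D : ℕ → ℕ) : Prop := ∀ k, 1 ≤ k → SolAt A D k

lemma Sol.symm {A D} (h : Sol A D) : Sol D A := fun k hk => by
  obtain ⟨h1, h2, h3⟩ := h k hk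
  exact ⟨h2, h1, h3.symm⟩

lemma lex_aux {A f g : ℕ → ℕ} (hf : Sol A f) (hg : Sol A g) {j0 : ℕ}
    (heq : ∀ j < j0, f j = g j) (hlt : g j0 < f j0) (k : ℕ) (hk : j0 + 1 ≤ k) :
    pT g k ≤ pT f k ∧ pS g k - pT g k < pS f k - pT f k ∧
    pT f k - pT g k ≤ ((k : ℤ) - 1) * ((pS f k - pT f k) - (pS g k - pT g k)) := by
  induction k, hk using Nat.le_induction with
  | base =>
    simp only [pT_succ, pS_succ, pT_congr heq, pS_congr heq]
    have : (g j0 : ℤ) < f j0 := by exact_mod_cast hlt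
    refine ⟨?_, by linarith, ?_⟩
    · have : (g j0 : ℤ) * j0 ≤ f j0 * j0 := by gcongr
      linarith
    · push_cast
      apply le_of_eq
      ring
  | succ k hk ih =>
    obtain ⟨h1, h2, h3⟩ := ih
    have hk1 : 1 ≤ k := by omega
    obtain ⟨a1, a2, a3⟩ := hf k hk1
    obtain ⟨b1, b2, b3⟩ := hg k hk1
    have hT : pT f (k+1) = pS A k := by
      rcases a3 with h | h
      · exact h
      · linarith
    have hτ : pT g (k+1) ≤ pT f (k+1) := by linarith
    have hI : ((k:ℤ)) * ((pS f (k+1) - pT f (k+1)) - (pS g (k+1) - pT g (k+1)))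
        - (pT f (k+1) - pT g (k+1)) =
        ((k : ℤ) - 1) * ((pS f k - pT f k) - (pS g k - pT g k)) - (pT f k - pT g k)
        + ((pS f k - pT f k) - (pS g k - pT g k)) := by
      simp only [pT_succ, pS_succ]; ring
    refine ⟨hτ, ?_, ?_⟩
    · by_contra hc
      push Not at hc
      have : ((k:ℤ)) * ((pS f (k+1) - pT f (k+1)) - (pS g (k+1) - pT g (k+1))) ≤ 0 :=
        mul_nonpos_of_nonneg_of_nonpos (by positivity) (by linarith)
      linarith
    · push_cast
      rw [add_sub_cancel_right]
      linarith

lemma lex_cmp {A : ℕ → ℕ} {f g : ℕ →₀ ℕ} (hf : Sol A f) (hg : Sol A g) (hne : f ≠ g) :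
    (tT g ≤ tT f ∧ tS g - tT g < tS f - tT f) ∨ (tT f ≤ tT g ∧ tS f - tT f < tS g - tT g) := by
  classical
  have hex : ∃ j, f j ≠ g j := by
    by_contra hc
    push Not at hc
    exact hne (Finsupp.ext hc)
  let j0 := Nat.find hex
  have h0 : f j0 ≠ g j0 := Nat.find_spec hex
  have hlt : ∀ j < j0, f j = g j := fun j hj => by
    have := Nat.find_min hex hj
    simpa using this
  obtain ⟨N1, hN1⟩ := exists_bd f
  obtain ⟨N2, hN2⟩ := exists_bd g
  let k := max (j0+1) (max N1 N2)
  have e1 := tT_eq f (k := k) fun j hj => hN1 j (by omega)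
  have e2 := tS_eq f (k := k) fun j hj => hN1 j (by omega)
  have e3 := tT_eq g (k := k) fun j hj => hN2 j (by omega)
  have e4 := tS_eq g (k := k) fun j hj => hN2 j (by omega)
  rcases lt_or_gt_of_ne h0 with h | h
  · right
    have := lex_aux hg hf (fun j hj => (hlt j hj).symm) h k (by omega)
    rw [e1, e2, e3, e4] at this
    exact ⟨this.1, this.2.1⟩
  · left
    have := lex_aux hf hg hlt h k (by omega)
    rw [e1, e2, e3, e4] at this
    exact ⟨this.1, this.2.1⟩

/-- Family of prefix solutions. -/
lemma family (A : ℕ → ℕ) (M : ℕ) : ∃ t0 : ℤ, t0 ≤ pS A M ∧ ∀ n : ℕ, ∃ f : ℕ → ℕ,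
    (∀ k, 1 ≤ k → k ≤ M → SolAt A f k) ∧
    pS f (M+1) - pT f (M+1) = pT A (M+1) - t0 + n ∧
    pT f (M+1) = min (t0 + M * n) (pS A M) ∧ (∀ j, M < j → f j = 0) := by
  induction M with
  | zero =>
    refine ⟨0, by simp [pS_zero], fun n => ⟨fun j => if j = 0 then n else 0, ?_, ?_, ?_, ?_⟩⟩
    · intro k h1 h2; omega
    · simp [pS, pT]
    · simp [pS, pT]
    · intro j hj; simp; omega
  | succ M ih =>
    obtain ⟨t0, ht0, H⟩ := ih
    have hA0 : (0:ℤ) ≤ A M := by positivity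
    have hA1 : (0:ℤ) ≤ A (M+1) := by positivity
    have hSA : pS A (M+1) = pS A M + A M * (M + 1) := pS_succ A M
    have hTA : pT A (M+2) = pT A (M+1) + A (M+1) * (M + 1) := by
      rw [pT_succ]; push_cast; ring
    have hMA : (0:ℤ) ≤ A M * (M+1) := by positivity
    -- extension of a prefix solution
    have ext : ∀ n' m : ℕ, ∀ T' : ℤ, T' = min (t0 + M * n') (pS A M) →
        pT A (M+2) ≤ pT A (M+1) - t0 + n' + T' →
        T' + m * (M+1) ≤ pS A (M+1) →
        (T' + m * (M+1) = pS A (M+1) ∨ pT A (M+2) = pT A (M+1) - t0 + n' + T') →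
        ∃ f : ℕ → ℕ, (∀ k, 1 ≤ k → k ≤ M+1 → SolAt A f k) ∧
          pS f (M+2) - pT f (M+2) = pT A (M+1) - t0 + n' + m ∧
          pT f (M+2) = T' + m * (M+1) ∧ (∀ j, M + 1 < j → f j = 0) := by
      intro n' m T' hT' h1 h2 h3
      obtain ⟨f, hf1, hf2, hf3, hf4⟩ := H n'
      rw [← hT'] at hf3
      let g : ℕ → ℕ := fun j => if j = M+1 then m else f j
      have hg : ∀ j < M+1, g j = f j := fun j hj => by
        simp only [g]; rw [if_neg (by omega)]
      have hgm : g (M+1) = m := by simp [g]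
      have hTg : ∀ k ≤ M+1, pT g k = pT f k := fun k hk => pT_congr fun j hj => hg j (by omega)
      have hSg : ∀ k ≤ M+1, pS g k = pS f k := fun k hk => pS_congr fun j hj => hg j (by omega)
      have hT2 : pT g (M+2) = T' + m * (M+1) := by
        rw [pT_succ, hTg _ le_rfl, hgm, hf3]; push_cast; ring
      have hS2 : pS g (M+2) = pS f (M+1) + m * (M+2) := by
        rw [pS_succ, hSg _ le_rfl, hgm]; push_cast; ring
      refine ⟨g, ?_, ?_, hT2, ?_⟩
      · intro k hk1 hk2
        rcases Nat.lt_or_ge M k with hk | hk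
        · obtain rfl : k = M+1 := by omega
          refine ⟨?_, ?_, ?_⟩
          · rw [hT2]; exact h2
          · rw [hSg _ le_rfl]; linarith
          · rw [hT2, hSg _ le_rfl]
            rcases h3 with h | h
            · left; exact h
            · right; linarith
        · have := hf1 k hk1 hk
          unfold SolAt at this ⊢
          rw [hTg _ (by omega), hSg _ (by omega)]
          exact this
      · rw [hT2, hS2]; linarith
      · intro j hj
        simp only [g]; rw [if_neg (by omega)]; exact hf4 j (by omega)
    -- the start of the new family
    obtain ⟨n1, hn1⟩ : ∃ n1 : ℕ, min (t0 + M * n1) (pS A M) = min (t0 + M * A (M+1)) (pS A M) ∧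
        (n1 : ℤ) = A (M+1) * (M+1) + t0 - min (t0 + M * A (M+1)) (pS A M) := by
      rcases le_total (t0 + M * A (M+1)) (pS A M) with h | h
      · refine ⟨A (M+1), rfl, ?_⟩
        rw [min_eq_left h]; ring
      · obtain ⟨x, hx⟩ := Int.eq_ofNat_of_zero_le (sub_nonneg.2 h)
        refine ⟨A (M+1) + x, ?_, ?_⟩
        · rw [min_eq_right h, min_eq_right]
          push_cast
          have : (0:ℤ) ≤ M * x := by positivity
          linarith
        · rw [min_eq_right h]
          push_cast
          rw [← hx]; ring
    set t1 := min (t0 + M * A (M+1)) (pS A M) with ht1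
    obtain ⟨hn1, hn1'⟩ := hn1
    have ht1B : t1 ≤ pS A M := min_le_right _ _
    have ht1n : t1 ≤ t0 + M * n1 := hn1 ▸ min_le_left _ _
    refine ⟨t1, by linarith, fun n => ?_⟩
    push_cast
    rcases le_or_gt (t1 + ((M:ℤ)+1) * n) (pS A (M+1)) with h | h
    · rw [min_eq_left h]
      obtain ⟨f, hf1, hf2, hf3, hf4⟩ := ext n1 n t1 hn1.symm (by linarith) (by linarith)
        (Or.inr (by linarith))
      exact ⟨f, hf1, by rw [hf2]; linarith, by rw [hf3]; ring, hf4⟩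
    · rw [min_eq_right h.le]
      have hnA : (A M : ℤ) < n := by
        by_contra hc
        push Not at hc
        have : ((M:ℤ)+1) * n ≤ (M+1) * A M := by gcongr
        linarith
      have hnA' : A M < n := by exact_mod_cast hnA
      obtain ⟨x, rfl⟩ := Nat.exists_eq_add_of_lt hnA'
      push_cast at h ⊢
      rcases le_or_gt (pS A M) (t0 + M * ((n1 + x + 1 : ℕ) : ℤ)) with hc | hc
      · obtain ⟨f, hf1, hf2, hf3, hf4⟩ := ext (n1 + x + 1) (A M) (pS A M) (by rw [min_eq_right hc])
          (by push_cast; linarith) (by linarith) (Or.inl (by linarith))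
        exact ⟨f, hf1, by rw [hf2]; push_cast; linarith, by rw [hf3]; linarith, hf4⟩
      · push_cast at hc
        obtain ⟨y, hy⟩ : ∃ y : ℕ, (y:ℤ) = t0 + (M+1) * (n1 + x + 1) - pS A M - n1 := by
          have : 0 ≤ t0 + ((M:ℤ)+1) * (n1 + x + 1) - pS A M - n1 := by nlinarith
          obtain ⟨y, hy⟩ := Int.eq_ofNat_of_zero_le this
          exact ⟨y, hy.symm⟩
        have hyx : (y:ℤ) < x + 1 := by rw [hy]; linarith
        have hyx' : y < x + 1 := by exact_mod_cast hyx
        obtain ⟨z, hz⟩ := Nat.exists_eq_add_of_le (Nat.lt_succ_iff.1 hyx')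
        have hz' : (x:ℤ) = y + z := by exact_mod_cast hz
        have hyc : (M:ℤ) * (n1 + y) ≤ M * (n1 + x + 1) :=
          mul_le_mul_of_nonneg_left (by linarith) (by positivity)
        have hle : t0 + M * ((n1 + y : ℕ) : ℤ) ≤ pS A M := by push_cast; linarith
        have hMy : (0:ℤ) ≤ M * y := by positivity
        have hkey : t0 + M * ((n1 + y : ℕ) : ℤ) + ((A M + z + 1 : ℕ) : ℤ) * (M+1) = pS A (M+1) := by
          push_cast
          rw [hSA]
          rw [hz'] at hy
          linarith
        obtain ⟨f, hf1, hf2, hf3, hf4⟩ := ext (n1 + y) (A M + z + 1)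
          (t0 + M * ((n1 + y : ℕ) : ℤ)) (by rw [min_eq_left hle])
          (by push_cast; linarith) (le_of_eq hkey) (Or.inl hkey)
        exact ⟨f, hf1, by rw [hf2]; push_cast; linarith, by rw [hf3, hkey], hf4⟩

lemma family' (A : ℕ →₀ ℕ) : ∃ t0 : ℤ, 0 ≤ t0 ∧ t0 ≤ tS A ∧ 
    (∃ D : ℕ →₀ ℕ, Sol A D ∧ tS D = tT A ∧ tT D = t0) ∧ 
    ∀ n : ℕ, tS A - t0 < n → ∃ D : ℕ →₀ ℕ, Sol A D ∧ tT D = tS A ∧ tS D = tT A + n := by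
  obtain ⟨N, hN⟩ := exists_bd A
  obtain ⟨M, hM1, hM2⟩ : ∃ M : ℕ, N ≤ M ∧ tS A ≤ M :=
    ⟨max N (tS A).toNat, le_max_left _ _, by
      have := Int.self_le_toNat (tS A)
      push_cast
      exact this.trans (le_max_right _ _)⟩
  have hS : ∀ k, M ≤ k → pS A k = tS A := fun k hk => tS_eq A fun j hj => hN j (by omega)
  have hT : ∀ k, M ≤ k → pT A k = tT A := fun k hk => tT_eq A fun j hj => hN j (by omega)
  obtain ⟨t0, ht0, H⟩ := family A M
  rw [hS M le_rfl] at ht0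
  have mk : ∀ n : ℕ, tT A - t0 + n + min (t0 + M * n) (tS A) = tT A ∨ 
      (min (t0 + M * n) (tS A) = tS A ∧ tT A ≤ tT A - t0 + n + tS A) →
      ∃ D : ℕ →₀ ℕ, Sol A D ∧ tT D = min (t0 + M * n) (tS A) ∧ 
        tS D = tT A - t0 + n + min (t0 + M * n) (tS A) := by
    intro n hn
    obtain ⟨f, hf1, hf2, hf3, hf4⟩ := H n
    rw [hT _ (by omega)] at hf2
    rw [hS _ le_rfl] at hf3
    let D : ℕ →₀ ℕ := Finsupp.onFinset (Finset.range (M+1)) f fun j hj => by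
      rw [Finset.mem_range]
      by_contra hc
      exact hj (hf4 j (by omega))
    have hDf : (D : ℕ → ℕ) = f := rfl
    have hD0 : ∀ k, M + 1 ≤ k → ∀ j, k ≤ j → D j = 0 := fun k hk j hj => hf4 j (by omega)
    have e1 : ∀ k, M+1 ≤ k → pT f k = tT D := fun k hk => tT_eq D (hD0 k hk)
    have e2 : ∀ k, M+1 ≤ k → pS f k = tS D := fun k hk => tS_eq D (hD0 k hk)
    rw [e1 _ le_rfl, e2 _ le_rfl] at hf2
    rw [e1 _ le_rfl] at hf3
    refine ⟨D, ?_, hf3, by linarith⟩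
    intro k hk
    rcases le_or_gt k M with h | h
    · exact hf1 k hk h
    · rw [hDf]
      refine ⟨?_, ?_, ?_⟩
      · rw [e1 _ (by omega), hS k (by omega), hf3]; exact min_le_right _ _
      · rw [e2 _ (by omega), hT _ (by omega)]; rcases hn with h | ⟨h, h'⟩ <;> linarith
      · rw [e1 _ (by omega), hS k (by omega), e2 _ (by omega), hT _ (by omega)]
        rcases hn with h | ⟨h, h'⟩
        · right; linarith
        · left; linarith
  have hm0 : min (t0 + (M:ℤ) * ((0:ℕ):ℤ)) (tS A) = t0 := by simpa using ht0
  obtain ⟨D0, hD0, hD1, hD2⟩ := mk 0 (Or.inl (by rw [hm0]; simp))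
  rw [hm0] at hD1 hD2
  have ht00 : 0 ≤ t0 := hD1 ▸ tT_nonneg D0
  refine ⟨t0, ht00, ht0, ⟨D0, hD0, by rw [hD2]; simp, hD1⟩, fun n hn => ?_⟩
  obtain ⟨x, hx⟩ := Int.eq_ofNat_of_zero_le (show 0 ≤ n - (tS A - t0) by linarith)
  have hx1 : (1:ℤ) ≤ x := by omega
  have hmx : min (t0 + (M:ℤ) * x) (tS A) = tS A := by
    apply min_eq_right
    have : (M:ℤ) * 1 ≤ M * x := by gcongr
    linarith
  obtain ⟨D, hD, hD3, hD4⟩ := mk x (Or.inr ⟨hmx, by linarith⟩)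
  rw [hmx] at hD3 hD4
  exact ⟨D, hD, hD3, by rw [hD4, ← hx]; ring⟩

lemma exists_zero (A : ℕ →₀ ℕ) : ∃ D : ℕ →₀ ℕ, Sol A D ∧ tS D = tT A ∧ tT D ≤ tS A := by
  obtain ⟨t0, _, h, ⟨D, hD, h1, h2⟩, _⟩ := family' A
  exact ⟨D, hD, h1, h2 ▸ h⟩

lemma exists_pos (A D' : ℕ →₀ ℕ) (hs : Sol A D') (h1 : tS D' = tT A) (n : ℕ)
    (hn : tS A - tT D' < n) : ∃ D : ℕ →₀ ℕ, Sol A D ∧ tT D = tS A ∧ tS D = tT A + n := by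
  obtain ⟨t0, _, _, ⟨D, hD, h2, h3⟩, H⟩ := family' A
  have : D = D' := by
    by_contra hne
    rcases lex_cmp hD hs hne with h | h <;> omega
  subst this
  exact H n (h3 ▸ hn)

/-! ### Vertices -/

lemma muLow_one (d : LusztigDatum) (k) : d.muLow alpha1 k = (pT d.a k, pS d.a k) := by
  ext <;> simp [LusztigDatum.muLow, alpha1, deltaL, pT, pS, Prod.fst_sum, Prod.snd_sum, add_comm]
lemma muLow_zero (d : LusztigDatum) (k) : d.muLow alpha0 k = (pS d.a k, pT d.a k) := by
  ext <;> simp [LusztigDatum.muLow, alpha0, deltaL, pT, pS, Prod.fst_sum, Prod.snd_sum, add_comm]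
lemma muInf_one (d : LusztigDatum) : d.muInf alpha1 = (tT d.a, tS d.a) := by
  ext <;> simp [LusztigDatum.muInf, alpha1, deltaL, tT, tS, Finsupp.sum, Prod.fst_sum,
    Prod.snd_sum, add_comm]
lemma muInf_zero (d : LusztigDatum) : d.muInf alpha0 = (tS d.a, tT d.a) := by
  ext <;> simp [LusztigDatum.muInf, alpha0, deltaL, tT, tS, Finsupp.sum, Prod.fst_sum,
    Prod.snd_sum, add_comm]
lemma muTopInf_one (d : LusztigDatum) :
    d.muTopInf alpha1 = (tT d.a + d.lam.sum, tS d.a + d.lam.sum) := by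
  ext <;> simp [LusztigDatum.muTopInf, muInf_one, deltaL]
lemma muTopInf_zero (d : LusztigDatum) :
    d.muTopInf alpha0 = (tS d.a + d.lam.sum, tT d.a + d.lam.sum) := by
  ext <;> simp [LusztigDatum.muTopInf, muInf_zero, deltaL]

lemma tail_sum (F : ℕ →₀ ℕ) (g : ℕ → ℤ) (k : ℕ) :
    ∑ j ∈ F.support.filter (fun j => k ≤ j), (F j : ℤ) * g j =
      (F.sum fun j m => (m : ℤ) * g j) - ∑ j ∈ Finset.range k, (F j : ℤ) * g j := by
  unfold Finsupp.sum
  rw [← Finset.sum_filter_add_sum_filter_not F.support (fun j => k ≤ j)]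
  have : ∑ j ∈ F.support.filter (fun j => ¬ k ≤ j), (F j : ℤ) * g j =
      ∑ j ∈ Finset.range k, (F j : ℤ) * g j := by
    apply Finset.sum_subset
    · intro j hj
      simp only [Finset.mem_filter] at hj
      rw [Finset.mem_range]; omega
    · intro j hj hj'
      simp only [Finset.mem_range, Finset.mem_filter, Finsupp.mem_support_iff] at hj hj'
      have : F j = 0 := by
        by_contra hc
        exact hj' ⟨hc, by omega⟩
      simp [this]
  rw [this]; ring

lemma muHigh_one (d : LusztigDatum) (k) : d.muHigh alpha1 alpha0 k =
    (tT d.a + d.lam.sum + (tS d.A - pS d.A k), tS d.a + d.lam.sum + (tT d.A - pT d.A k)) := by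
  unfold tS tT pS pT
  rw [← tail_sum, ← tail_sum]
  ext <;> simp [LusztigDatum.muHigh, muTopInf_one, alpha0, deltaL, Prod.fst_sum, Prod.snd_sum,
    add_comm, tS, tT]
lemma muHigh_zero (d : LusztigDatum) (k) : d.muHigh alpha0 alpha1 k =
    (tS d.a + d.lam.sum + (tT d.A - pT d.A k), tT d.a + d.lam.sum + (tS d.A - pS d.A k)) := by
  unfold tS tT pS pT
  rw [← tail_sum, ← tail_sum]
  ext <;> simp [LusztigDatum.muHigh, muTopInf_zero, alpha1, deltaL, Prod.fst_sum, Prod.snd_sum,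
    add_comm, tS, tT]

lemma closing_iff (R L : LusztigDatum) :
    R.muHigh alpha1 alpha0 0 = L.muHigh alpha0 alpha1 0 ↔
    tT R.a + R.lam.sum + tS R.A = tS L.a + L.lam.sum + tT L.A ∧
    tS R.a + R.lam.sum + tT R.A = tT L.a + L.lam.sum + tS L.A := by
  simp [muHigh_one, muHigh_zero, pS_zero, pT_zero]

lemma MVPolytope.close1 (P : MVPolytope) :
    tT P.R.a + P.R.lam.sum + tS P.R.A = tS P.L.a + P.L.lam.sum + tT P.L.A :=
  ((closing_iff _ _).1 P.closing).1
lemma MVPolytope.close2 (P : MVPolytope) :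
    tS P.R.a + P.R.lam.sum + tT P.R.A = tT P.L.a + P.L.lam.sum + tS P.L.A :=
  ((closing_iff _ _).1 P.closing).2

lemma MVPolytope.solLow (P : MVPolytope) : Sol P.R.a P.L.a := fun k hk => by
  have := P.cond_low (k+1) (by omega)
  simp only [muLow_one, muLow_zero, Nat.add_sub_cancel, Prod.fst_sub, Prod.snd_sub] at this
  unfold SolAt
  omega

lemma MVPolytope.solHigh (P : MVPolytope) : Sol P.R.A P.L.A := fun k hk => by
  have := P.cond_high (k+1) (by omega)
  have h1 := P.close1
  have h2 := P.close2
  simp only [muHigh_one, muHigh_zero, Nat.add_sub_cancel, Prod.fst_sub, Prod.snd_sub] at this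
  unfold SolAt
  omega

/-- Exchange of left and right. -/
def MVPolytope.swap (P : MVPolytope) : MVPolytope where
  R := P.L
  L := P.R
  closing := (closing_iff _ _).2 ⟨P.close2.symm, P.close1.symm⟩
  cond_low := fun k hk => by
    have := P.cond_low k hk
    simp only [muLow_one, muLow_zero, Prod.fst_sub, Prod.snd_sub] at this ⊢
    exact ⟨this.2.1, this.1, this.2.2.symm⟩
  cond_high := fun k hk => by
    have := P.cond_high k hk
    simp only [muHigh_one, muHigh_zero, Prod.fst_sub, Prod.snd_sub] at this ⊢
    exact ⟨this.2.1, this.1, this.2.2.symm⟩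
  cond_parts := by
    have := P.cond_parts
    simp only [muInf_one, muInf_zero, muTopInf_one, muTopInf_zero, Prod.fst_sub,
      Prod.snd_sub] at this ⊢
    split_ifs at this with h
    · rw [if_pos (by linarith)]; exact this.symm
    · rw [if_neg (fun hc => h (by linarith))]
      obtain ⟨n, hn, h'⟩ := this
      exact ⟨n, by linarith, h'.symm⟩
  cond_size := fun x hx => by
    have := P.cond_size x hx.symm
    simp only [muInf_one, muInf_zero, Prod.fst_sub, Prod.snd_sub] at this ⊢
    linarith

lemma eq_single {F : ℕ →₀ ℕ} (h : ∀ k, 1 ≤ k → F k = 0) : F = Finsupp.single 0 (F 0) := by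
  ext j
  rcases Nat.eq_zero_or_pos j with rfl | hj
  · simp
  · rw [h j hj, Finsupp.single_apply, if_neg (by omega)]

/-- Top polytope with `R.a = r` at index 0 and `L.a = 0`. -/
def TopR (r : ℕ) (P : MVPolytope) : Prop :=
  P.R.lam = 0 ∧ P.L.lam = 0 ∧ P.R.a = Finsupp.single 0 r ∧ P.L.a = 0

def TopI (i : ZMod 2) (r : ℕ) (P : MVPolytope) : Prop :=
  if i = 1 then TopR r P else TopR r P.swap

lemma TopR.isTop {r P} (h : TopR r P) : IsTopMV P := by
  obtain ⟨h1, h2, h3, h4⟩ := h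
  refine ⟨h1, h2, fun k hk => ?_, fun k hk => by simp [h4]⟩
  rw [h3, Finsupp.single_apply, if_neg (by omega)]

lemma isTop_swap {P} (h : IsTopMV P) : IsTopMV P.swap := ⟨h.2.1, h.1, h.2.2.2, h.2.2.1⟩

lemma TopI.isTop {i r P} (h : TopI i r P) : IsTopMV P := by
  unfold TopI at h
  split_ifs at h
  · exact h.isTop
  · exact isTop_swap h.isTop

lemma exists_topI {P} (h : IsTopMV P) : ∃ i r, TopI i r P := by
  obtain ⟨h1, h2, h3, h4⟩ := h
  have e1 := eq_single h3
  have e2 := eq_single h4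
  have hs := P.solLow 1 le_rfl
  unfold SolAt at hs
  simp only [pT, pS, Finset.sum_range_succ, Finset.sum_range_zero, h3 1 le_rfl, h4 1 le_rfl] at hs
  have : P.R.a 0 = 0 ∨ P.L.a 0 = 0 := by
    rcases hs.2.2 with h | h <;> simp at h <;> omega
  rcases this with h | h
  · refine ⟨0, P.L.a 0, ?_⟩
    rw [TopI, if_neg (by decide)]
    refine ⟨h2, h1, e2, ?_⟩
    rw [h, Finsupp.single_zero] at e1
    exact e1
  · refine ⟨1, P.R.a 0, ?_⟩
    rw [TopI, if_pos rfl]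
    refine ⟨h1, h2, e1, ?_⟩
    rw [h] at e2
    simpa using e2

lemma stepUp {P Q : MVPolytope} {l n : ℕ} (hP : TopR l P.swap) (hln : l < n)
    (hf : MVf 1 n P Q) : TopR n Q := by
  obtain ⟨p1, p2, p3, p4⟩ := hP
  simp only [MVPolytope.swap] at p1 p2 p3 p4
  rw [MVf, if_pos rfl] at hf
  obtain ⟨q1, q2, q3⟩ := hf
  rw [p4, zero_add] at q1
  rw [p2] at q2
  have c1 := P.close1
  have c2 := P.close2
  have d1 := Q.close1
  have d2 := Q.close2
  have sP := P.solHigh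
  have sQ := Q.solHigh
  rw [p1, p2, p3, p4] at c1 c2
  rw [q1, q2, q3] at d1 d2
  rw [q3] at sQ
  simp only [tT_single, tS_single, tT_zero, tS_zero, Multiset.sum_zero, Nat.cast_zero, zero_add,
    add_zero] at c1 c2 d1 d2
  have hln' : (l:ℤ) < n := by exact_mod_cast hln
  obtain ⟨D, hD, hD1, hD2⟩ := exists_pos P.R.A P.L.A sP c2.symm n (by linarith)
  have t1 := tT_le_tS Q.L.a
  have t2 := tT_nonneg Q.L.a
  have hE : Q.L.A = D := by
    by_contra hne
    rcases lex_cmp sQ hD hne with h | h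
    · have : (0:ℤ) ≤ Q.L.lam.sum := by positivity
      linarith
    · linarith
  rw [hE] at d1 d2
  have hs0 : Q.L.lam.sum = 0 := by
    have : (0:ℤ) ≤ Q.L.lam.sum := by positivity
    omega
  refine ⟨q2, ?_, q1, tS_eq_zero (by linarith)⟩
  rw [Multiset.eq_zero_iff_forall_notMem]
  intro x hx
  have := Q.L.lam_pos x hx
  have := Multiset.le_sum_of_mem hx
  omega

lemma stepDown {P : MVPolytope} {r : ℕ} (hP : TopR r P) (hr : 0 < r) :
    ∃ Q : MVPolytope, ∃ l : ℕ, l < r ∧ TopR l Q.swap ∧ MVf 1 r Q P := by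
  obtain ⟨p1, p2, p3, p4⟩ := hP
  have c1 := P.close1
  have c2 := P.close2
  have sP := P.solHigh
  rw [p1, p2, p3, p4] at c1 c2
  simp only [tT_single, tS_single, tT_zero, tS_zero, Multiset.sum_zero, Nat.cast_zero, zero_add,
    add_zero] at c1 c2
  obtain ⟨D, hD, h1, h2⟩ := exists_zero P.R.A
  obtain ⟨l, hl⟩ := Int.eq_ofNat_of_zero_le (sub_nonneg.2 h2)
  have hr' : (0:ℤ) < r := by exact_mod_cast hr
  have hlr : (l:ℤ) < r := by
    have hne : P.L.A ≠ D := by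
      intro h
      rw [h] at c2
      linarith
    rcases lex_cmp sP hD hne with h | h <;> linarith
  let R : LusztigDatum := ⟨0, 0, P.R.A, by simp⟩
  let L : LusztigDatum := ⟨Finsupp.single 0 l, 0, D, by simp⟩
  have hpT : ∀ k, pT (Finsupp.single 0 l : ℕ →₀ ℕ) k = 0 := fun k =>
    Finset.sum_eq_zero fun j _ => by
      rcases Nat.eq_zero_or_pos j with rfl | hj
      · simp
      · rw [Finsupp.single_apply, if_neg (by omega)]; simp
  have hpS : ∀ k, 0 ≤ pS (Finsupp.single 0 l : ℕ →₀ ℕ) k := fun k => by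
    rw [← pS_zero (Finsupp.single 0 l : ℕ →₀ ℕ)]; exact pS_mono _ (Nat.zero_le _)
  have z1 : ∀ k, pT ((0 : ℕ →₀ ℕ)) k = 0 := fun k => by simp [pT]
  have z2 : ∀ k, pS ((0 : ℕ →₀ ℕ)) k = 0 := fun k => by simp [pS]
  let Q : MVPolytope :=
    { R := R
      L := L
      closing := by
        rw [closing_iff]
        simp only [R, L, tT_single, tS_single, tT_zero, tS_zero, Multiset.sum_zero,
          Nat.cast_zero, zero_add, add_zero]
        exact ⟨by linarith, by linarith⟩
      cond_low := fun k hk => by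
        simp only [muLow_one, muLow_zero, Prod.fst_sub, Prod.snd_sub, R, L, hpT, z1, z2]
        have := hpS (k-1)
        refine ⟨by simp, by linarith, Or.inl (by simp)⟩
      cond_high := fun k hk => by
        obtain ⟨k, rfl⟩ : ∃ m, k = m + 1 := ⟨k - 1, by omega⟩
        have := hD k (by omega)
        unfold SolAt at this
        simp only [muHigh_one, muHigh_zero, Prod.fst_sub, Prod.snd_sub, R, L, tT_single,
          tS_single, tT_zero, tS_zero, Multiset.sum_zero, Nat.cast_zero, zero_add, add_zero,
          Nat.add_sub_cancel]
        omega
      cond_parts := by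
        simp only [muInf_one, muInf_zero, muTopInf_one, muTopInf_zero, R, L, tT_single,
          tS_single, tT_zero, tS_zero, Multiset.sum_zero, Nat.cast_zero, add_zero,
          Prod.fst_sub, Prod.snd_sub]
        rw [if_pos (by ring)]
        trivial
      cond_size := fun x hx => by simp [R, L] at hx }
  refine ⟨Q, l, by exact_mod_cast hlr, ⟨rfl, rfl, rfl, rfl⟩, ?_⟩
  rw [MVf, if_pos rfl]
  exact ⟨by simp [Q, R, p3], p1, rfl⟩

lemma zmod_cases (i : ZMod 2) : i = 0 ∨ i = 1 := by revert i; decide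

lemma MVf_swap {n P Q} : MVf 0 n P Q ↔ MVf 1 n P.swap Q.swap := by
  rw [MVf, MVf, if_pos rfl, if_neg (by decide)]; rfl

lemma topI_zero {r P} : TopI 0 r P ↔ TopR r P.swap := by rw [TopI, if_neg (by decide)]
lemma topI_one {r P} : TopI 1 r P ↔ TopR r P := by rw [TopI, if_pos rfl]

lemma stepUpI {i : ZMod 2} {P Q : MVPolytope} {l n : ℕ} (hP : TopI (i+1) l P) (hln : l < n)
    (hf : MVf i n P Q) : TopI i n Q := by
  rcases zmod_cases i with rfl | rfl
  · rw [zero_add, topI_one] at hP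
    rw [topI_zero]
    exact stepUp (P := P.swap) hP hln (MVf_swap.1 hf)
  · rw [show (1 + 1 : ZMod 2) = 0 by decide, topI_zero] at hP
    rw [topI_one]
    exact stepUp hP hln hf

lemma stepDownI {i : ZMod 2} {P : MVPolytope} {r : ℕ} (hP : TopI i r P) (hr : 0 < r) :
    ∃ Q : MVPolytope, ∃ l : ℕ, l < r ∧ TopI (i+1) l Q ∧ MVf i r Q P := by
  rcases zmod_cases i with rfl | rfl
  · rw [topI_zero] at hP
    obtain ⟨Q, l, h1, h2, h3⟩ := stepDown hP hr
    exact ⟨Q.swap, l, h1, by rw [zero_add, topI_one]; exact h2, MVf_swap.2 h3⟩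
  · rw [topI_one] at hP
    obtain ⟨Q, l, h1, h2, h3⟩ := stepDown hP hr
    exact ⟨Q, l, h1, by rw [show (1 + 1 : ZMod 2) = 0 by decide, topI_zero]; exact h2, h3⟩

lemma trivial_of_topR {P} (h : TopR 0 P) : IsTrivialMV P := by
  obtain ⟨p1, p2, p3, p4⟩ := h
  have c1 := P.close1
  have c2 := P.close2
  rw [p1, p2, p3, p4] at c1 c2
  simp only [tT_single, tS_single, tT_zero, tS_zero, Multiset.sum_zero, Nat.cast_zero, zero_add,
    add_zero] at c1 c2
  have t1 := tT_le_tS P.R.A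
  have t2 := tT_le_tS P.L.A
  exact ⟨by simpa using p3, p1, eq_zero_of_tS_le_tT (by linarith), p4, p2,
    eq_zero_of_tS_le_tT (by linarith)⟩

lemma trivial_of_topI {i P} (h : TopI i 0 P) : IsTrivialMV P := by
  rcases zmod_cases i with rfl | rfl
  · obtain ⟨a, b, c, d, e, f⟩ := trivial_of_topR (topI_zero.1 h)
    exact ⟨d, e, f, a, b, c⟩
  · exact trivial_of_topR (topI_one.1 h)

lemma topI_of_trivial {P} (i) (h : IsTrivialMV P) : TopI i 0 P := by
  obtain ⟨a, b, c, d, e, f⟩ := h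
  rcases zmod_cases i with rfl | rfl
  · exact topI_zero.2 ⟨e, b, by rw [Finsupp.single_zero]; exact d, a⟩
  · exact topI_one.2 ⟨b, e, by simpa using a, d⟩

lemma word_of_topI (r : ℕ) : ∀ (i : ZMod 2) (P : MVPolytope), TopI i r P →
    ∃ (t : ℕ) (k : ℕ → ℕ) (i' : ℕ → ZMod 2),
        (∀ j, j + 1 < t → k (j + 1) < k j) ∧
        (∀ j, j < t → 0 < k j) ∧
        (∀ j, j + 1 < t → i' (j + 1) = i' j + 1) ∧
        FWordChain t k i' P ∧ k 0 = r ∧ i' 0 = i := by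
  induction r using Nat.strong_induction_on with
  | _ r ih =>
    intro i P hP
    rcases Nat.eq_zero_or_pos r with rfl | hr
    · refine ⟨0, fun _ => 0, fun _ => i, by simp, by simp, by simp, ?_, rfl, rfl⟩
      exact ⟨fun _ => P, trivial_of_topI hP, rfl, by simp⟩
    · obtain ⟨Q, l, hl, hQ, hf⟩ := stepDownI hP hr
      obtain ⟨t, k, i', h1, h2, h3, ⟨W, w1, w2, w3⟩, h5, h6⟩ := ih l hl _ Q hQ
      refine ⟨t+1, fun j => Nat.casesOn j r k, fun j => Nat.casesOn j i i', ?_, ?_, ?_, ?_,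
        rfl, rfl⟩
      · rintro (_ | j) hj
        · change k 0 < r
          omega
        · exact h1 j (by omega)
      · rintro (_ | j) hj
        · exact hr
        · exact h2 j (by omega)
      · rintro (_ | j) hj
        · exact h6
        · exact h3 j (by omega)
      · refine ⟨fun j => Nat.casesOn j P W, w1, rfl, ?_⟩
        rintro (_ | j) hj
        · change MVf i r (W 0) P
          rw [w2]; exact hf
        · exact w3 j (by omega)

lemma topI_of_word (t : ℕ) : ∀ (k : ℕ → ℕ) (i : ℕ → ZMod 2) (P : MVPolytope),
        (∀ j, j + 1 < t → k (j + 1) < k j) →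
        (∀ j, j < t → 0 < k j) →
        (∀ j, j + 1 < t → i (j + 1) = i j + 1) →
        FWordChain t k i P → if t = 0 then IsTrivialMV P else TopI (i 0) (k 0) P := by
  induction t with
  | zero =>
    rintro k i P - - - ⟨Q, q1, q2, -⟩
    rw [if_pos rfl, ← q2]; exact q1
  | succ t ih =>
    rintro k i P h1 h2 h3 ⟨Q, q1, q2, q3⟩
    rw [if_neg (by omega)]
    have := ih (fun j => k (j+1)) (fun j => i (j+1)) (Q 1) (fun j hj => h1 (j+1) (by omega))
      (fun j hj => h2 (j+1) (by omega)) (fun j hj => h3 (j+1) (by omega))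
      ⟨fun j => Q (j+1), q1, rfl, fun j hj => q3 (j+1) (by omega)⟩
    have hf := q3 0 (by omega)
    rw [q2] at hf
    split_ifs at this with ht
    · exact stepUpI (topI_of_trivial _ this) (h2 0 (by omega)) hf
    · simp only [zero_add] at this
      have e := h3 0 (by omega)
      rw [zero_add] at e
      rw [e] at this
      exact stepUpI this (h1 0 (by omega)) hf

/-- `P` is a top polytope iff `P = f_{i_1}^{k_1} ⋯ f_{i_t}^{k_t}(P₀)` for
some strictly decreasing positive exponents and alternating indices in `ℤ/2ℤ`. -/
theorem isTopMV_iff_word (P : MVPolytope) :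
    IsTopMV P ↔
      ∃ (t : ℕ) (k : ℕ → ℕ) (i : ℕ → ZMod 2),
        (∀ j, j + 1 < t → k (j + 1) < k j) ∧
        (∀ j, j < t → 0 < k j) ∧
        (∀ j, j + 1 < t → i (j + 1) = i j + 1) ∧
        FWordChain t k i P := by
  constructor
  · intro h
    obtain ⟨i, r, hi⟩ := exists_topI h
    obtain ⟨t, k, i', h1, h2, h3, h4, -, -⟩ := word_of_topI r i P hi
    exact ⟨t, k, i', h1, h2, h3, h4⟩
  · rintro ⟨t, k, i, h1, h2, h3, h4⟩
    have := topI_of_word t k i P h1 h2 h3 h4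
    split_ifs at this with ht
    · exact (topI_of_trivial 1 this).isTop
    · exact this.isTop

end MVPaper
end

section
/- Let Λ ∈ V be such that α_0(Λ) and α_1(Λ) are nonnegative integers, and let π_Λ(t) = tΛ. Let k_1 > k_2 > ⋯ > k_t > 0 be integers and i_1, …, i_t ∈ ℤ/2ℤ with i_{j+1} = i_j + 1, and suppose π = f_{i_1}^{k_1} ⋯ f_{i_t}^{k_t}(π_Λ) is defined (every application of a lowering operator in this word is defined). Then both decorations of π vanish: π has no α_0-zigzag and no α_1-zigzag at any k > 0, and for each i ∈ ℤ/2ℤ with N := ε_i(π) > 0, π does not attain min α_i∘π = −N at a time belonging to an α_{i+1}-stable section at N. -/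
open Set

namespace MVPaper

variable {V : Type*} [AddCommGroup V] [Module ℝ V]

/-- `π` is piecewise linear (affine) on `[0,1]`. -/
def IsPWLinearOn (π : ℝ → V) : Prop :=
  ∃ (n : ℕ) (t : Fin (n + 1) → ℝ), Monotone t ∧ t 0 = 0 ∧ t (Fin.last n) = 1 ∧
    ∀ i : Fin n, ∃ a b : V, ∀ s ∈ Set.Icc (t i.castSucc) (t i.succ), π s = s • a + b

/-- A path: continuous piecewise linear with `π 0 = 0`. -/
def IsPath (π : ℝ → V) : Prop := π 0 = 0 ∧ IsPWLinearOn π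

/-- `t ∈ (0,1)` is a local minimum point of `f`. -/
def IsLocalMinPt (f : ℝ → ℝ) (t : ℝ) : Prop :=
  t ∈ Set.Ioo (0 : ℝ) 1 ∧ ∀ᶠ s in nhds t, f t ≤ f s

/-- `f` takes integer values at `0`, `1` and at local minimum points. -/
def IsIntegralFn (f : ℝ → ℝ) : Prop :=
  (∃ m : ℤ, f 0 = m) ∧ (∃ m : ℤ, f 1 = m) ∧ ∀ t, IsLocalMinPt f t → ∃ m : ℤ, f t = m

def IsZeroSectionAt (f : ℝ → ℝ) (m a b : ℝ) : Prop :=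
  0 ≤ a ∧ a < b ∧ b ≤ 1 ∧ ∀ t ∈ Set.Icc a b, f t = m

def IsPreStableAt (f : ℝ → ℝ) (m a b : ℝ) : Prop :=
  0 ≤ a ∧ a < b ∧ b ≤ 1 ∧ f a = m ∧ f b = m ∧ ∀ t ∈ Set.Ioo a b, m < f t

/-- A stable section: maximal among intervals on which `f` equals `m` at the ends and is
`> m` inside, for some integer level. -/
def IsStableSectionAt (f : ℝ → ℝ) (m a b : ℝ) : Prop :=
  IsPreStableAt f m a b ∧
    ∀ (m' : ℤ) (a' b' : ℝ), IsPreStableAt f (m' : ℝ) a' b' → a' ≤ a → b ≤ b' →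
      a' = a ∧ b' = b

def IsPosDirectedSectionAt (f : ℝ → ℝ) (m a b : ℝ) : Prop :=
  0 ≤ a ∧ a < b ∧ b ≤ 1 ∧ f a = m ∧ f b = m + 1 ∧
    ∀ t ∈ Set.Ioo a b, m < f t ∧ f t < m + 1

def IsNegDirectedSectionAt (f : ℝ → ℝ) (m a b : ℝ) : Prop :=
  0 ≤ a ∧ a < b ∧ b ≤ 1 ∧ f a = m ∧ f b = m - 1 ∧
    ∀ t ∈ Set.Ioo a b, m - 1 < f t ∧ f t < m

def IsSectionAt (f : ℝ → ℝ) (a b : ℝ) : Prop :=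
  ∃ m : ℤ, IsZeroSectionAt f (m : ℝ) a b ∨ IsStableSectionAt f (m : ℝ) a b ∨
    IsPosDirectedSectionAt f (m : ℝ) a b ∨ IsNegDirectedSectionAt f (m : ℝ) a b

/-- `a` and `b` are consecutive elements of the finite set `T`. -/
def Adjacent (T : Finset ℝ) (a b : ℝ) : Prop :=
  a ∈ T ∧ b ∈ T ∧ a < b ∧ ∀ c ∈ T, c ≤ a ∨ b ≤ c

/-- `T` is a subdivision of `[0,1]` each of whose consecutive intervals is a section of `f`. -/
def IsSectionDecomposition (f : ℝ → ℝ) (T : Finset ℝ) : Prop :=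
  (0 : ℝ) ∈ T ∧ (1 : ℝ) ∈ T ∧ (T : Set ℝ) ⊆ Set.Icc 0 1 ∧
    ∀ a b : ℝ, Adjacent T a b → IsSectionAt f a b

def NoTwoConsecutiveZeroSections (f : ℝ → ℝ) (T : Finset ℝ) : Prop :=
  ∀ a b c : ℝ, Adjacent T a b → Adjacent T b c →
    ¬ ((∃ m : ℤ, IsZeroSectionAt f (m : ℝ) a b) ∧ (∃ m : ℤ, IsZeroSectionAt f (m : ℝ) b c))

/-- `Q_β(π) = min β∘π` on `[0,1]`. -/
noncomputable def Qval (β : V →ₗ[ℝ] ℝ) (π : ℝ → V) : ℝ :=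
  sInf ((fun t => β (π t)) '' Set.Icc (0 : ℝ) 1)

/-- The reflection `s_β(v) = v - β(v)β^∨`. -/
def sRefl (β : V →ₗ[ℝ] ℝ) (βv : V) (v : V) : V := v - β v • βv

/-- `q`, the first time the minimum of `β∘π` is attained. -/
noncomputable def qTime (β : V →ₗ[ℝ] ℝ) (π : ℝ → V) : ℝ :=
  sInf {t | t ∈ Set.Icc (0 : ℝ) 1 ∧ β (π t) = Qval β π}

/-- `y`, the last time before `q` where `β∘π = Q+1`. -/
noncomputable def yTime (β : V →ₗ[ℝ] ℝ) (π : ℝ → V) : ℝ :=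
  sSup {t | t ∈ Set.Icc (0 : ℝ) 1 ∧ t < qTime β π ∧ β (π t) = Qval β π + 1}

/-- Littelmann raising operator. -/
noncomputable def eOp (β : V →ₗ[ℝ] ℝ) (βv : V) (π : ℝ → V) : ℝ → V := fun t =>
  if t ≤ yTime β π then π t
  else if t ≤ qTime β π then π (yTime β π) + sRefl β βv (π t - π (yTime β π))
  else π t + βv

/-- `p`, the last time the minimum of `β∘π` is attained. -/
noncomputable def pTime (β : V →ₗ[ℝ] ℝ) (π : ℝ → V) : ℝ :=
  sSup {t | t ∈ Set.Icc (0 : ℝ) 1 ∧ β (π t) = Qval β π}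

/-- `x`, the first time after `p` where `β∘π = Q+1`. -/
noncomputable def xTime (β : V →ₗ[ℝ] ℝ) (π : ℝ → V) : ℝ :=
  sInf {t | t ∈ Set.Icc (0 : ℝ) 1 ∧ pTime β π < t ∧ β (π t) = Qval β π + 1}

/-- Littelmann lowering operator. -/
noncomputable def fOp (β : V →ₗ[ℝ] ℝ) (βv : V) (π : ℝ → V) : ℝ → V := fun t =>
  if t ≤ pTime β π then π t
  else if t ≤ xTime β π then π (pTime β π) + sRefl β βv (π t - π (pTime β π))
  else π t - βv

noncomputable def phiVal (β : V →ₗ[ℝ] ℝ) (π : ℝ → V) : ℝ := β (π 1) - Qval β π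

/-- `e_β^{max}`: iterate `e_β` while `Q_β ≤ -1`, i.e. `ε_β(π)` many times. -/
noncomputable def eMax (β : V →ₗ[ℝ] ℝ) (βv : V) (π : ℝ → V) : ℝ → V :=
  (eOp β βv)^[⌊-(Qval β π)⌋₊] π

/-- `f_β^{max}`: iterate `f_β` while `φ_β ≥ 1`, i.e. `φ_β(π)` many times. -/
noncomputable def fMax (β : V →ₗ[ℝ] ℝ) (βv : V) (π : ℝ → V) : ℝ → V :=
  (fOp β βv)^[⌊phiVal β π⌋₊] π


/-- The affine `sl₂` root datum. -/
def IsAffineSL2 (a0 a1 : V →ₗ[ℝ] ℝ) (v0 v1 : V) : Prop :=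
  a0 v0 = 2 ∧ a1 v1 = 2 ∧ a0 v1 = -2 ∧ a1 v0 = -2

/-- `π` is integral: `β∘π` is integral for every positive real root `β = α_i + kδ`. -/
def IsIntegralPathSL2 (a0 a1 : V →ₗ[ℝ] ℝ) (π : ℝ → V) : Prop :=
  ∀ k : ℕ, IsIntegralFn (fun t => (a0 + (k : ℝ) • (a0 + a1)) (π t)) ∧
    IsIntegralFn (fun t => (a1 + (k : ℝ) • (a0 + a1)) (π t))

/-- `[s,v]` is an `α_i`-zigzag of `π` at `k`: it contains an `α_i`-stable section `[s,u]`
at `k` and an `α_{i+1}`-stable section `[t,v]` at `-k` with `s ≤ t ≤ u ≤ v`, and on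
`[s,v]` one has `α_i ≥ k` and `α_{i+1} ≥ -k`. -/
def IsZigzagInterval (βi βi1 : V →ₗ[ℝ] ℝ) (π : ℝ → V) (k : ℤ) (s v : ℝ) : Prop :=
  ∃ t u : ℝ, s ≤ t ∧ t ≤ u ∧ u ≤ v ∧
    IsStableSectionAt (fun r => βi (π r)) (k : ℝ) s u ∧
    IsStableSectionAt (fun r => βi1 (π r)) (-k : ℝ) t v ∧
    (∀ r ∈ Set.Icc s v, (k : ℝ) ≤ βi (π r)) ∧
    (∀ r ∈ Set.Icc s v, (-k : ℝ) ≤ βi1 (π r))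

/-- `π` has an `α_i`-zigzag at `k` (with `βi = α_i`, `βi1 = α_{i+1}`). -/
def HasZigzagAt (βi βi1 : V →ₗ[ℝ] ℝ) (π : ℝ → V) (k : ℤ) : Prop :=
  ∃ s v : ℝ, IsZigzagInterval βi βi1 π k s v

/-- The number `m_{i,k}(π)` of `α_i`-zigzags of `π` at `k`. -/
noncomputable def zigzagCount (βi βi1 : V →ₗ[ℝ] ℝ) (π : ℝ → V) (k : ℤ) : ℕ :=
  Nat.card {p : ℝ × ℝ // IsZigzagInterval βi βi1 π k p.1 p.2}

/-- The simple root `α_i`, `i ∈ ℤ/2ℤ`. -/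
def rootOf (a0 a1 : V →ₗ[ℝ] ℝ) : ZMod 2 → (V →ₗ[ℝ] ℝ) := fun i => if i = 0 then a0 else a1

/-- The simple coroot `α_i^∨`, `i ∈ ℤ/2ℤ`. -/
def corootOf (v0 v1 : V) : ZMod 2 → V := fun i => if i = 0 then v0 else v1

/-! ### Scalar analysis on `[0,1]` -/

/-- Lipschitz on `[0,1]`. -/
def LipI (f : ℝ → ℝ) : Prop :=
  ∃ K > 0, ∀ s ∈ Icc (0 : ℝ) 1, ∀ t ∈ Icc (0 : ℝ) 1, |f s - f t| ≤ K * |s - t|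

/-- Relative local minima on `[0,1]` have integer values. -/
def IntMin (f : ℝ → ℝ) : Prop :=
  ∀ w ∈ Icc (0 : ℝ) 1, (∃ ε > 0, ∀ s ∈ Icc (0 : ℝ) 1, |s - w| < ε → f w ≤ f s) →
    ∃ m : ℤ, f w = m

/-- `h` is the future minimum of `b`. -/
def FutMin (b h : ℝ → ℝ) : Prop :=
  ∀ t ∈ Icc (0 : ℝ) 1, (∃ w ∈ Icc t 1, b w = h t) ∧ ∀ s ∈ Icc t 1, h t ≤ b s

/-- The bad configuration. -/
def Bad (y x : ℝ → ℝ) : Prop :=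
  ∃ u v : ℝ, 0 ≤ u ∧ u ≤ v ∧ v ≤ 1 ∧ x v + y u ≤ 0 ∧ (x v < 0 ∨ y u < 0)

/-- The induction invariant. -/
structure Good (l : ℝ) (y x : ℝ → ℝ) (κ : ℝ) : Prop where
  lipy : LipI y
  lipx : LipI x
  inty : IntMin y
  intx : IntMin x
  y0 : y 0 = 0
  sum : ∀ t ∈ Icc (0 : ℝ) 1, x t + y t = l * t
  low : ∀ t ∈ Icc (0 : ℝ) 1, -κ ≤ y t
  nb : ¬ Bad y x

lemma LipI.continuousOn {f : ℝ → ℝ} (hf : LipI f) : ContinuousOn f (Icc 0 1) := by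
  obtain ⟨K, hK, h⟩ := hf
  have : LipschitzOnWith (Real.toNNReal K) f (Icc 0 1) := by
    apply LipschitzOnWith.of_dist_le_mul
    intro s hs t ht
    rw [Real.dist_eq, Real.dist_eq, Real.coe_toNNReal _ hK.le]
    exact h s hs t ht
  exact this.continuousOn

lemma LipI.congr {f g : ℝ → ℝ} (hf : LipI f) (h : ∀ t ∈ Icc (0 : ℝ) 1, g t = f t) : LipI g := by
  obtain ⟨K, hK, hh⟩ := hf
  refine ⟨K, hK, fun s hs t ht => ?_⟩
  rw [h s hs, h t ht]; exact hh s hs t ht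

lemma LipI.add_mul {f g : ℝ → ℝ} (hf : LipI f) (hg : LipI g) (r : ℝ) :
    LipI (fun t => f t + r * g t) := by
  obtain ⟨K, hK, h1⟩ := hf
  obtain ⟨L, hL, h2⟩ := hg
  refine ⟨K + |r| * L, by positivity, fun s hs t ht => ?_⟩
  have e : f s + r * g s - (f t + r * g t) = (f s - f t) + r * (g s - g t) := by ring
  simp only
  rw [e]
  calc _ ≤ |f s - f t| + |r * (g s - g t)| := abs_add_le _ _
    _ ≤ K * |s - t| + |r| * (L * |s - t|) := by
        rw [abs_mul]
        gcongr
        · exact h1 s hs t ht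
        · exact h2 s hs t ht
    _ = _ := by ring

lemma IntMin.congr {f g : ℝ → ℝ} (hf : IntMin f) (h : ∀ t ∈ Icc (0 : ℝ) 1, g t = f t) :
    IntMin g := by
  rintro w hw ⟨ε, hε, H⟩
  rw [h w hw]
  refine hf w hw ⟨ε, hε, fun s hs hsw => ?_⟩
  rw [← h s hs, ← h w hw]; exact H s hs hsw

lemma Good.congr {l κ : ℝ} {y x y' x' : ℝ → ℝ} (g : Good l y x κ)
    (hy : ∀ t ∈ Icc (0 : ℝ) 1, y' t = y t) (hx : ∀ t ∈ Icc (0 : ℝ) 1, x' t = x t) :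
    Good l y' x' κ where
  lipy := g.lipy.congr hy
  lipx := g.lipx.congr hx
  inty := g.inty.congr hy
  intx := g.intx.congr hx
  y0 := by rw [hy 0 (by simp), g.y0]
  sum t ht := by rw [hy t ht, hx t ht, g.sum t ht]
  low t ht := by rw [hy t ht]; exact g.low t ht
  nb := by
    rintro ⟨u, v, hu, huv, hv, h⟩
    rw [hy u ⟨hu, huv.trans hv⟩, hx v ⟨hu.trans huv, hv⟩] at h
    exact g.nb ⟨u, v, hu, huv, hv, h⟩

lemma Good.nonneg {l κ : ℝ} {y x : ℝ → ℝ} (g : Good l y x κ) :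
    ∀ t ∈ Icc (0 : ℝ) 1, 0 ≤ x t := by
  intro t ht
  by_contra hlt
  push Not at hlt
  exact g.nb ⟨0, t, le_rfl, ht.1, ht.2, by rw [g.y0]; linarith, Or.inl hlt⟩

lemma exists_futMin {b : ℝ → ℝ} (hb : LipI b) : ∃ h, FutMin b h := by
  have : ∀ t : ℝ, ∃ r : ℝ, t ∈ Icc (0 : ℝ) 1 →
      (∃ w ∈ Icc t 1, b w = r) ∧ ∀ s ∈ Icc t 1, r ≤ b s := by
    intro t
    by_cases ht : t ∈ Icc (0 : ℝ) 1
    · have hc : ContinuousOn b (Icc t 1) :=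
        hb.continuousOn.mono (Icc_subset_Icc ht.1 le_rfl)
      obtain ⟨w, hw, hm⟩ := isCompact_Icc.exists_isMinOn ⟨t, ⟨le_rfl, ht.2⟩⟩ hc
      exact ⟨b w, fun _ => ⟨⟨w, hw, rfl⟩, fun s hs => hm hs⟩⟩
    · exact ⟨0, fun h => absurd h ht⟩
  choose h hh using this
  exact ⟨h, hh⟩

section fut
variable {b h : ℝ → ℝ}

lemma FutMin.le (H : FutMin b h) {t : ℝ} (ht : t ∈ Icc (0 : ℝ) 1) : h t ≤ b t :=
  (H t ht).2 t ⟨le_rfl, ht.2⟩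

lemma FutMin.mono (H : FutMin b h) {s t : ℝ} (hs : 0 ≤ s) (hst : s ≤ t) (ht : t ≤ 1) :
    h s ≤ h t := by
  obtain ⟨w, hw, e⟩ := (H t ⟨hs.trans hst, ht⟩).1
  rw [← e]
  exact (H s ⟨hs, hst.trans ht⟩).2 w ⟨hst.trans hw.1, hw.2⟩

/-- If the future minimum after `t` is attained later than `t`, it is an integer. -/
lemma FutMin.int_of_later (H : FutMin b h) (hi : IntMin b) {t w : ℝ} (ht : 0 ≤ t) (htw : t < w)
    (hw : w ≤ 1) (e : b w = h t) : ∃ m : ℤ, h t = m := by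
  rw [← e]
  refine hi w ⟨by linarith, hw⟩ ⟨w - t, by linarith, fun s hs hsw => ?_⟩
  rw [e]
  refine (H t ⟨ht, by linarith⟩).2 s ⟨?_, hs.2⟩
  have := (abs_lt.1 hsw).1
  linarith

lemma FutMin.int_of_lt (H : FutMin b h) (hi : IntMin b) {t : ℝ} (ht : t ∈ Icc (0 : ℝ) 1)
    (hlt : h t < b t) : ∃ m : ℤ, h t = m := by
  obtain ⟨w, hw, e⟩ := (H t ht).1
  refine H.int_of_later hi ht.1 (lt_of_le_of_ne hw.1 ?_) hw.2 e
  rintro rfl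
  linarith

lemma FutMin.lip (H : FutMin b h) (hb : LipI b) (k : ℝ) : LipI (fun t => min k (h t)) := by
  obtain ⟨K, hK, hb⟩ := hb
  refine ⟨K, hK, ?_⟩
  have key : ∀ s t : ℝ, 0 ≤ s → s ≤ t → t ≤ 1 →
      |min k (h s) - min k (h t)| ≤ K * |s - t| := by
    intro s t hs hst ht
    have hm := H.mono hs hst ht
    have h1 : h t - h s ≤ K * (t - s) := by
      obtain ⟨w, hw, e⟩ := (H s ⟨hs, hst.trans ht⟩).1
      have hn : 0 ≤ K * (t - s) := mul_nonneg hK.le (by linarith)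
      rcases le_total t w with htw | hwt
      · have := (H t ⟨hs.trans hst, ht⟩).2 w ⟨htw, hw.2⟩
        linarith
      · have h2 := H.le (t := t) ⟨hs.trans hst, ht⟩
        have h3 := hb t ⟨hs.trans hst, ht⟩ w ⟨hs.trans hw.1, hw.2⟩
        rw [abs_of_nonneg (show 0 ≤ t - w by linarith)] at h3
        have h4 := (abs_le.1 h3).2
        have h5 : K * (t - w) ≤ K * (t - s) := by
          apply mul_le_mul_of_nonneg_left _ hK.le
          linarith [hw.1]
        linarith
    have h6 : min k (h s) ≤ min k (h t) := min_le_min le_rfl hm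
    rw [abs_of_nonpos (by linarith), abs_of_nonpos (by linarith)]
    have h7 : min k (h t) ≤ min k (h s) + (h t - h s) := by
      rcases le_total k (h s) with h' | h'
      · rw [min_eq_left h', min_eq_left (h'.trans hm)]; linarith
      · rw [min_eq_right h']
        exact (min_le_right _ _).trans (by linarith)
    linarith
  intro s hs t ht
  rcases le_total s t with hst | hst
  · exact key s t hs.1 hst ht.2
  · rw [abs_sub_comm, abs_sub_comm s t]; exact key t s ht.1 hst hs.2

/-- Where `min k h < b`, the function `min k h` is integer valued and locally constant. -/
lemma FutMin.loc (H : FutMin b h) (hb : LipI b) (hi : IntMin b) (k : ℕ) {w : ℝ}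
    (hw : w ∈ Icc (0 : ℝ) 1) (hlt : min (k : ℝ) (h w) < b w) :
    (∃ m : ℤ, min (k : ℝ) (h w) = m) ∧
    ∃ ε > 0, ∀ s ∈ Icc (0 : ℝ) 1, |s - w| < ε → min (k : ℝ) (h s) = min (k : ℝ) (h w) := by
  constructor
  · rcases le_total (k : ℝ) (h w) with h1 | h1
    · exact ⟨k, by rw [min_eq_left h1]; simp⟩
    · rw [min_eq_right h1] at hlt ⊢
      exact H.int_of_lt hi hw hlt
  · obtain ⟨K, hK, hb⟩ := hb
    set c := min (k : ℝ) (h w) with hc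
    have near : ∀ s ∈ Icc (0 : ℝ) 1, |s - w| < (b w - c) / K → c < b s := by
      intro s hs hsw
      have h1 := hb s hs w hw
      rw [lt_div_iff₀ hK] at hsw
      have h2 := (abs_le.1 h1).1
      linarith
    refine ⟨(b w - c) / K, div_pos (by linarith) hK, fun s hs hsw => ?_⟩
    have hck : c ≤ k := min_le_left _ _
    rcases le_total w s with hws | hws
    · apply le_antisymm _ (min_le_min le_rfl (H.mono hw.1 hws hs.2))
      rcases le_total (k : ℝ) (h w) with h1 | h1
      · rw [min_eq_left h1]; exact min_le_left _ _
      · have hcw : c = h w := by rw [hc, min_eq_right h1]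
        obtain ⟨z, hz, e⟩ := (H w hw).1
        rcases lt_or_ge z s with hzs | hzs
        · exfalso
          have : c < b z := near z ⟨hw.1.trans hz.1, hz.2⟩ (by
            rw [abs_of_nonneg (by linarith)] at hsw
            rw [abs_of_nonneg (by linarith [hz.1])]
            linarith)
          linarith
        · have := (H s hs).2 z ⟨hzs, hz.2⟩
          exact (min_le_right _ _).trans (by linarith)
    · apply le_antisymm (min_le_min le_rfl (H.mono hs.1 hws hw.2))
      refine le_min hck ?_
      obtain ⟨z, hz, e⟩ := (H s hs).1
      rw [← e]
      rcases lt_or_ge z w with hzw | hzw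
      · refine (near z ⟨hs.1.trans hz.1, hz.2⟩ ?_).le
        rw [abs_of_nonpos (by linarith)] at hsw
        rw [abs_of_nonpos (by linarith [hz.1])]
        linarith [hz.1]
      · exact (min_le_right _ _).trans ((H w hw).2 z ⟨hzw, hz.2⟩)

end fut

/-- The inductive step for the scalar data. -/
lemma Good.step {l κ : ℝ} {a b h : ℝ → ℝ} (g : Good l a b κ) (H : FutMin b h) (k : ℕ)
    (hκ : κ < k) (hb1 : (k : ℝ) ≤ b 1) :
    Good l (fun t => b t + (-2) * min (k : ℝ) (h t)) (fun t => a t + 2 * min (k : ℝ) (h t)) k := by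
  have I1 : (1 : ℝ) ∈ Icc (0 : ℝ) 1 := by simp
  have I0 : (0 : ℝ) ∈ Icc (0 : ℝ) 1 := by simp
  have hnn := g.nonneg
  have hl : 0 < l := by
    have := g.sum 1 I1
    have := g.low 1 I1
    linarith
  have hb0 : b 0 = 0 := by have := g.sum 0 I0; rw [g.y0] at this; linarith
  have hhnn : ∀ t ∈ Icc (0 : ℝ) 1, 0 ≤ h t := by
    intro t ht
    obtain ⟨w, hw, e⟩ := (H t ht).1
    rw [← e]; exact hnn w ⟨ht.1.trans hw.1, hw.2⟩
  have hk0 : (0 : ℝ) ≤ k := Nat.cast_nonneg k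
  have hc0 : min (k : ℝ) (h 0) = 0 := by
    have h1 := H.le I0
    have h2 := hhnn 0 I0
    rw [show h 0 = 0 by linarith]; exact min_eq_right hk0
  have hcb : ∀ t ∈ Icc (0 : ℝ) 1, min (k : ℝ) (h t) ≤ b t :=
    fun t ht => (min_le_right _ _).trans (H.le ht)
  have hcm : ∀ s t : ℝ, 0 ≤ s → s ≤ t → t ≤ 1 → min (k : ℝ) (h s) ≤ min (k : ℝ) (h t) :=
    fun s t h1 h2 h3 => min_le_min le_rfl (H.mono h1 h2 h3)
  have hclip := H.lip g.lipx k
  refine ⟨g.lipx.add_mul hclip _, g.lipy.add_mul hclip _, ?_, ?_, ?_, ?_, ?_, ?_⟩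
  · -- integrality of the reflected root
    rintro w hw ⟨ε, hε, hmin⟩
    simp only at hmin ⊢
    rcases (hcb w hw).lt_or_eq with hlt | heq
    · obtain ⟨⟨m, hm⟩, ε', hε', hloc⟩ := H.loc g.lipx g.intx k hw hlt
      obtain ⟨n, hn⟩ := g.intx w hw ⟨min ε ε', lt_min hε hε', fun s hs hsw => by
        have h1 := hmin s hs (hsw.trans_le (min_le_left _ _))
        have h2 := hloc s hs (hsw.trans_le (min_le_right _ _))
        rw [h2] at h1; linarith⟩
      exact ⟨n + (-2) * m, by rw [hm, hn]; push_cast; ring⟩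
    · suffices hs : ∃ m : ℤ, min (k : ℝ) (h w) = m by
        obtain ⟨m, hm⟩ := hs
        exact ⟨-m, by rw [← heq, hm]; push_cast; ring⟩
      rcases le_or_gt (k : ℝ) (h w) with hkh | hkh
      · exact ⟨k, by rw [min_eq_left hkh]; simp⟩
      rw [min_eq_right hkh.le] at heq ⊢
      by_contra hni
      have hw1 : w < 1 := by
        refine lt_of_le_of_ne hw.2 ?_
        rintro rfl
        linarith
      have hfl : (⌊h w⌋ : ℝ) < h w := lt_of_le_of_ne (Int.floor_le _) fun e => hni ⟨_, e.symm⟩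
      have hfk : (⌊h w⌋ : ℝ) + 1 ≤ k := by
        have : ⌊h w⌋ < (k : ℤ) := by
          rw [Int.floor_lt]; simpa using hkh
        exact_mod_cast this
      have hlf : h w < ⌊h w⌋ + 1 := Int.lt_floor_add_one _
      obtain ⟨K, hK, hKL⟩ := hclip
      set d := min (min (ε / 2) (1 - w)) ((⌊h w⌋ + 1 - h w) / (2 * K)) with hd
      have hdpos : 0 < d := by
        refine lt_min (lt_min (by linarith) (by linarith)) (div_pos (by linarith) (by linarith))
      have hd1 : d ≤ ε / 2 := (min_le_left _ _).trans (min_le_left _ _)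
      have hd2 : d ≤ 1 - w := (min_le_left _ _).trans (min_le_right _ _)
      have hd3 : d * (2 * K) ≤ ⌊h w⌋ + 1 - h w := by
        rw [← le_div_iff₀ (by linarith)]; exact min_le_right _ _
      have hs : w + d ∈ Icc (0 : ℝ) 1 := ⟨by linarith [hw.1], by linarith⟩
      have hL := hKL (w + d) hs w hw
      simp only at hL
      rw [show w + d - w = d by ring, abs_of_pos hdpos, min_eq_right hkh.le] at hL
      have hL2 := (abs_le.1 hL).2
      have hKd : 0 < K * d := mul_pos hK hdpos
      have hcs : min (k : ℝ) (h (w + d)) < ⌊h w⌋ + 1 := by nlinarith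
      have hhs : h (w + d) < ⌊h w⌋ + 1 := by
        rcases min_lt_iff.1 hcs with h1 | h1
        · linarith
        · exact h1
      have hmon := H.mono hw.1 (show w ≤ w + d by linarith) hs.2
      have hbs : b (w + d) = h (w + d) := by
        by_contra hne
        have hlt : h (w + d) < b (w + d) := lt_of_le_of_ne (H.le hs) (Ne.symm hne)
        obtain ⟨m, hm⟩ := H.int_of_lt g.intx hs hlt
        rw [hm] at hhs hmon
        have h1 : (⌊h w⌋ : ℝ) < m := by linarith
        have h2 : ⌊h w⌋ < m := by exact_mod_cast h1
        have h3 : m < ⌊h w⌋ + 1 := by exact_mod_cast hhs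
        omega
      have hms := hmin (w + d) hs (by
        rw [show w + d - w = d by ring, abs_of_pos hdpos]; linarith)
      rw [min_eq_right hkh.le, min_eq_right (show h (w + d) ≤ k by linarith)] at hms
      exact hni (H.int_of_later g.intx hw.1 (show w < w + d by linarith) hs.2 (by linarith))
  · -- integrality of the other root
    rintro w hw ⟨ε, hε, hmin⟩
    simp only at hmin ⊢
    rcases (hcb w hw).lt_or_eq with hlt | heq
    · obtain ⟨⟨m, hm⟩, ε', hε', hloc⟩ := H.loc g.lipx g.intx k hw hlt
      obtain ⟨n, hn⟩ := g.inty w hw ⟨min ε ε', lt_min hε hε', fun s hs hsw => by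
        have h1 := hmin s hs (hsw.trans_le (min_le_left _ _))
        have h2 := hloc s hs (hsw.trans_le (min_le_right _ _))
        rw [h2] at h1; linarith⟩
      exact ⟨n + 2 * m, by rw [hm, hn]; push_cast; ring⟩
    · rcases hw.1.eq_or_lt with h0 | h0
      · exact ⟨0, by rw [← h0, hc0, g.y0]; simp⟩
      exfalso
      set d := min (ε / 2) w with hd
      have hdpos : 0 < d := lt_min (by linarith) h0
      have hd1 : d ≤ ε / 2 := min_le_left _ _
      have hd2 : d ≤ w := min_le_right _ _
      have hs : w - d ∈ Icc (0 : ℝ) 1 := ⟨by linarith, by linarith [hw.2]⟩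
      have h1 := hmin (w - d) hs (by
        rw [show w - d - w = -d by ring, abs_neg, abs_of_pos hdpos]; linarith)
      have h2 := hcb (w - d) hs
      have h3 := hcm (w - d) w hs.1 (by linarith) hw.2
      have h4 := g.sum w hw
      have h5 := g.sum (w - d) hs
      have h6 : 0 < l * d := mul_pos hl hdpos
      have h7 : l * (w - d) = l * w - l * d := by ring
      linarith
  · simp only [hb0, hc0]; ring
  · intro t ht
    try simp only
    linarith [g.sum t ht]
  · intro t ht
    try simp only
    have := hcb t ht
    have h2 : min (k : ℝ) (h t) ≤ k := min_le_left _ _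
    linarith
  · rintro ⟨u, v, hu, huv, hv, hle, hor⟩
    simp only at hle hor
    have hv' : v ∈ Icc (0 : ℝ) 1 := ⟨hu.trans huv, hv⟩
    have h1 := hcb u ⟨hu, huv.trans hv⟩
    have h2 := hcm u v hu huv hv
    have h3 : 0 ≤ min (k : ℝ) (h v) := le_min hk0 (hhnn v hv')
    have h4 : a v ≤ - min (k : ℝ) (h v) := by linarith
    have h5 : a v < 0 := by
      rcases hor with h | h <;> linarith
    have h6 := g.low v hv'
    have h7 : min (k : ℝ) (h v) < k := by linarith
    have h8 : h v < k := by
      rcases min_lt_iff.1 h7 with h' | h'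
      · exact absurd h' (lt_irrefl _)
      · exact h'
    rw [min_eq_right h8.le] at h4
    obtain ⟨w, hw, e⟩ := (H v hv').1
    exact g.nb ⟨v, w, hv'.1, hw.1, hw.2, by linarith, Or.inr h5⟩

/-- Iterated lowering operator applied to a path with `ε = 0`. -/
lemma fOp_iterate (β : V →ₗ[ℝ] ℝ) (βv : V) (hβ : β βv = 2) (τ : ℝ → V) (h : ℝ → ℝ)
    (hlip : LipI (fun t => β (τ t))) (hint : IntMin (fun t => β (τ t)))
    (h0 : β (τ 0) = 0) (hnn : ∀ t ∈ Icc (0 : ℝ) 1, 0 ≤ β (τ t))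
    (H : FutMin (fun t => β (τ t)) h) (k : ℕ)
    (hdef : ∀ m, m < k → 1 ≤ phiVal β ((fOp β βv)^[m] τ)) :
    (k : ℝ) ≤ β (τ 1) ∧
    ∀ t ∈ Icc (0 : ℝ) 1, (fOp β βv)^[k] τ t = τ t - min (k : ℝ) (h t) • βv := by
  have I1 : (1 : ℝ) ∈ Icc (0 : ℝ) 1 := by simp
  have I0 : (0 : ℝ) ∈ Icc (0 : ℝ) 1 := by simp
  set b : ℝ → ℝ := fun t => β (τ t) with hb
  have hhnn : ∀ t ∈ Icc (0 : ℝ) 1, 0 ≤ h t := by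
    intro t ht
    obtain ⟨w, hw, e⟩ := (H t ht).1
    rw [← e]; exact hnn w ⟨ht.1.trans hw.1, hw.2⟩
  induction k with
  | zero =>
    refine ⟨by simpa using hnn 1 I1, fun t ht => ?_⟩
    simp [min_eq_left (hhnn t ht)]
  | succ m ih =>
    obtain ⟨hm1, hform⟩ := ih fun j hj => hdef j (by omega)
    have hphi := hdef m (by omega)
    rw [Function.iterate_succ_apply']
    set ρ := (fOp β βv)^[m] τ with hρ
    have hcont := hlip.continuousOn
    have hβρ : ∀ t ∈ Icc (0 : ℝ) 1, β (ρ t) = b t - 2 * min (m : ℝ) (h t) := by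
      intro t ht
      rw [hform t ht, map_sub, map_smul, hβ]
      simp only [smul_eq_mul, hb]; ring
    -- the last time where `b = m`
    obtain ⟨p, ⟨hp, hbp⟩, hplast⟩ : ∃ p, (p ∈ Icc (0 : ℝ) 1 ∧ b p = m) ∧
        ∀ t ∈ Icc (0 : ℝ) 1, p < t → (m : ℝ) < b t := by
      have hcl : IsCompact (Icc (0 : ℝ) 1 ∩ b ⁻¹' (Iic (m : ℝ))) :=
        isCompact_Icc.of_isClosed_subset
          (hcont.preimage_isClosed_of_isClosed isClosed_Icc isClosed_Iic) inter_subset_left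
      obtain ⟨p, hp, hmax⟩ := hcl.exists_isGreatest ⟨0, I0, by simp [hb, h0]⟩
      have hl : ∀ t ∈ Icc (0 : ℝ) 1, p < t → (m : ℝ) < b t := by
        intro t ht hpt
        by_contra hle
        push Not at hle
        have := hmax ⟨ht, hle⟩
        linarith
      refine ⟨p, ⟨hp.1, ?_⟩, hl⟩
      have hbp : b p ≤ m := hp.2
      obtain ⟨q, hq, hbq⟩ := intermediate_value_Icc hp.1.2
        (hcont.mono (Icc_subset_Icc hp.1.1 le_rfl)) (show (m : ℝ) ∈ Icc (b p) (b 1) from ⟨hbp, hm1⟩)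
      have hq2 : q ≤ p := hmax ⟨⟨hp.1.1.trans hq.1, hq.2⟩, le_of_eq hbq⟩
      have : q = p := le_antisymm hq2 hq.1
      rw [← this]; exact hbq
    have hhp : h p = m := by
      apply le_antisymm (hbp ▸ H.le hp)
      obtain ⟨w, hw, e⟩ := (H p hp).1
      rw [← e]
      rcases hw.1.eq_or_lt with h1 | h1
      · rw [← h1, hbp]
      · exact (hplast w ⟨hp.1.trans hw.1, hw.2⟩ h1).le
    have hafter : ∀ t ∈ Icc (0 : ℝ) 1, p < t → (m : ℝ) < h t := by
      intro t ht hpt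
      obtain ⟨w, hw, e⟩ := (H t ht).1
      rw [← e]
      exact hplast w ⟨ht.1.trans hw.1, hw.2⟩ (hpt.trans_le hw.1)
    have hρp : β (ρ p) = -m := by
      rw [hβρ p hp, hbp, hhp, min_self]; ring
    have hρge : ∀ t ∈ Icc (0 : ℝ) 1, -(m : ℝ) ≤ β (ρ t) := by
      intro t ht
      rw [hβρ t ht]
      have h1 := H.le ht
      have h2 : min (m : ℝ) (h t) ≤ m := min_le_left _ _
      have h3 : min (m : ℝ) (h t) ≤ h t := min_le_right _ _
      linarith
    have hQ : Qval β ρ = -m := by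
      refine IsLeast.csInf_eq ⟨⟨p, hp, hρp⟩, ?_⟩
      rintro _ ⟨t, ht, rfl⟩
      exact hρge t ht
    have hafter' : ∀ t ∈ Icc (0 : ℝ) 1, p < t → β (ρ t) = b t - 2 * m := by
      intro t ht hpt
      rw [hβρ t ht, min_eq_left (hafter t ht hpt).le]
    have hpT : pTime β ρ = p := by
      refine IsGreatest.csSup_eq ⟨⟨hp, by rw [hQ, hρp]⟩, ?_⟩
      rintro t ⟨ht, e⟩
      by_contra hlt
      push Not at hlt
      rw [hafter' t ht hlt, hQ] at e
      have := hplast t ht hlt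
      linarith
    have hb1 : (m : ℝ) + 1 ≤ b 1 := by
      unfold phiVal at hphi
      rw [hQ, hβρ 1 I1] at hphi
      have h1 : h 1 = b 1 := by
        obtain ⟨w, hw, e⟩ := (H 1 I1).1
        have : w = 1 := le_antisymm hw.2 hw.1
        rw [← e, this]
      have hm1' : (m : ℝ) ≤ b 1 := hm1
      rw [h1, min_eq_left hm1'] at hphi
      linarith
    have hp1 : p < 1 := by
      refine lt_of_le_of_ne hp.2 ?_
      rintro rfl
      linarith
    -- the first time after `p` where `b = m + 1`
    obtain ⟨x, ⟨hpx, hx1, hbx⟩, hxfirst⟩ : ∃ x, (p < x ∧ x ≤ 1 ∧ b x = m + 1) ∧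
        ∀ t ∈ Icc (0 : ℝ) 1, p < t → t < x → b t < m + 1 := by
      have hcont' := hcont.mono (Icc_subset_Icc hp.1 (le_refl (1 : ℝ)))
      have hcl : IsCompact (Icc p 1 ∩ b ⁻¹' (Ici ((m : ℝ) + 1))) :=
        isCompact_Icc.of_isClosed_subset
          (hcont'.preimage_isClosed_of_isClosed isClosed_Icc isClosed_Ici) inter_subset_left
      obtain ⟨x, hx, hmin⟩ := hcl.exists_isLeast ⟨1, ⟨hp.2, le_rfl⟩, hb1⟩
      have hbx : (m : ℝ) + 1 ≤ b x := hx.2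
      obtain ⟨q, hq, hbq⟩ := intermediate_value_Icc hx.1.1
        (hcont.mono (Icc_subset_Icc hp.1 hx.1.2))
        (show (m : ℝ) + 1 ∈ Icc (b p) (b x) from ⟨by linarith, hbx⟩)
      have hq2 : x ≤ q := hmin ⟨⟨hq.1, hq.2.trans hx.1.2⟩, le_of_eq hbq.symm⟩
      have hqx : q = x := le_antisymm hq.2 hq2
      rw [hqx] at hbq
      refine ⟨x, ⟨lt_of_le_of_ne hx.1.1 ?_, hx.1.2, hbq⟩, ?_⟩
      · rintro rfl
        linarith
      · intro t ht hpt htx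
        by_contra hge
        push Not at hge
        have := hmin ⟨⟨hpt.le, ht.2⟩, hge⟩
        linarith
    have hx : x ∈ Icc (0 : ℝ) 1 := ⟨hp.1.trans hpx.le, hx1⟩
    have hxT : xTime β ρ = x := by
      unfold xTime
      rw [hpT, hQ]
      refine IsLeast.csInf_eq ⟨⟨hx, hpx, ?_⟩, ?_⟩
      · rw [hafter' x hx hpx, hbx]; ring
      · rintro t ⟨ht, hpt, e⟩
        by_contra hlt
        push Not at hlt
        have := hxfirst t ht hpt hlt
        rw [hafter' t ht hpt] at e
        linarith
    have noint : ∀ r : ℝ, (m : ℝ) < r → r < m + 1 → ¬ ∃ n : ℤ, r = n := by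
      rintro r h1 h2 ⟨n, rfl⟩
      have h3 : (m : ℤ) < n := by exact_mod_cast h1
      have h4 : n < (m : ℤ) + 1 := by exact_mod_cast h2
      omega
    have hhx : (m : ℝ) + 1 ≤ h x := by
      by_contra hlt
      push Not at hlt
      exact noint (h x) (hafter x hx hpx) hlt
        (H.int_of_lt hint hx (by rw [hbx]; exact hlt))
    refine ⟨by push_cast; exact hb1, fun t ht => ?_⟩
    unfold fOp
    rw [hpT, hxT]
    push_cast
    split_ifs with c1 c2
    · rw [hform t ht]
      have h1 : h t ≤ m := hhp ▸ H.mono ht.1 c1 hp.2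
      rw [min_eq_right h1, min_eq_right (by linarith)]
    · push Not at c1
      have hbt : b t ≤ m + 1 := by
        rcases c2.lt_or_eq with c | c
        · exact (hxfirst t ht c1 c).le
        · rw [c, hbx]
      have hht : h t = b t := by
        by_contra hne
        have hlt : h t < b t := lt_of_le_of_ne (H.le ht) hne
        exact noint (h t) (hafter t ht c1) (by linarith) (H.int_of_lt hint ht hlt)
      unfold sRefl
      rw [map_sub, hρp, hafter' t ht c1, hform t ht, min_eq_left (hafter t ht c1).le, hht,
        min_eq_right hbt]
      have e : τ t - b t • βv = τ t - (m : ℝ) • βv - (b t - 2 * m - -m) • βv := by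
        module
      rw [e]; abel
    · push Not at c1 c2
      have h1 := H.mono hx.1 c2.le ht.2
      rw [hform t ht, min_eq_left (hafter t ht c1).le, min_eq_left (by linarith)]
      module

/-- One letter of the word. -/
lemma Good.word_step {l κ : ℝ} (β γ : V →ₗ[ℝ] ℝ) (βv : V) (hβ : β βv = 2) (hγ : γ βv = -2)
    (τ : ℝ → V) (g : Good l (fun t => γ (τ t)) (fun t => β (τ t)) κ) (k : ℕ) (hκ : κ < k)
    (hdef : ∀ m, m < k → 1 ≤ phiVal β ((fOp β βv)^[m] τ)) :
    Good l (fun t => β ((fOp β βv)^[k] τ t)) (fun t => γ ((fOp β βv)^[k] τ t)) k := by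
  obtain ⟨h, H⟩ := exists_futMin g.lipx
  have hb0 : β (τ 0) = 0 := by
    have h1 := g.sum 0 (by simp)
    have h2 := g.y0
    try simp only at h1 h2
    linarith
  obtain ⟨h1, h2⟩ := fOp_iterate β βv hβ τ h g.lipx g.intx hb0 g.nonneg H k hdef
  refine (g.step H k hκ h1).congr ?_ ?_
  · intro t ht
    try simp only
    rw [h2 t ht, map_sub, map_smul, hβ, smul_eq_mul]; ring
  · intro t ht
    try simp only
    rw [h2 t ht, map_sub, map_smul, hγ, smul_eq_mul]; ring

lemma good_line {p q : ℝ} (hp : 0 ≤ p) (hq : 0 ≤ q) :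
    Good (p + q) (fun t => t * p) (fun t => t * q) 0 := by
  have lip : ∀ r : ℝ, 0 ≤ r → LipI (fun t => t * r) := by
    intro r hr
    refine ⟨r + 1, by linarith, fun s _ t _ => ?_⟩
    simp only
    rw [← sub_mul, abs_mul, abs_of_nonneg hr, mul_comm]
    exact mul_le_mul_of_nonneg_right (by linarith) (abs_nonneg _)
  have int : ∀ r : ℝ, 0 ≤ r → IntMin (fun t => t * r) := by
    rintro r hr w hw ⟨ε, hε, hmin⟩
    simp only at hmin ⊢
    refine ⟨0, ?_⟩
    rcases hw.1.eq_or_lt with h0 | h0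
    · rw [← h0]; simp
    have hdpos : 0 < min (ε / 2) w := lt_min (by linarith) h0
    have hd1 : min (ε / 2) w ≤ ε / 2 := min_le_left _ _
    have hd2 : min (ε / 2) w ≤ w := min_le_right _ _
    set d := min (ε / 2) w
    have h1 := hmin (w - d) ⟨by linarith, by linarith [hw.2]⟩ (by
      rw [show w - d - w = -d by ring, abs_neg, abs_of_pos hdpos]; linarith)
    have h2 : d * r ≤ 0 := by linarith [sub_mul w d r]
    have h3 : r ≤ 0 := by
      by_contra hr'
      push Not at hr'
      have := mul_pos hdpos hr'
      linarith
    have : r = 0 := le_antisymm h3 hr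
    simp [this]
  refine ⟨lip p hp, lip q hq, int p hp, int q hq, by simp, fun t _ => by ring, ?_, ?_⟩
  · intro t ht
    simpa using mul_nonneg ht.1 hp
  · rintro ⟨u, v, hu, huv, hv, -, hor⟩
    have h1 : 0 ≤ v * q := mul_nonneg (hu.trans huv) hq
    have h2 : 0 ≤ u * p := mul_nonneg hu hp
    simp only at hor
    rcases hor with h | h <;> linarith

lemma Good.final {l κ : ℝ} {y x : ℝ → ℝ} (g : Good l y x κ) {u v N : ℝ} (hu : 0 ≤ u)
    (huv : u ≤ v) (hv : v ≤ 1) (hN : 0 < N) :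
    ¬ (y u = -N ∧ x v = N) ∧ ¬ (x u = -N ∧ y v = N) := by
  constructor
  · rintro ⟨h1, h2⟩
    exact g.nb ⟨u, v, hu, huv, hv, by linarith, Or.inr (by linarith)⟩
  · rintro ⟨h1, -⟩
    have := g.nonneg u ⟨hu, huv.trans hv⟩
    linarith

lemma zmod2_cases (z : ZMod 2) : z = 0 ∨ z = 1 := by
  revert z; decide

/-- If `π = f_{i_1}^{k_1} ⋯ f_{i_t}^{k_t}(π_Λ)` with `k_1 > ⋯ > k_t > 0`,
alternating indices, every lowering operator application being defined, and `Λ` dominant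
integral, then both decorations of `π` vanish: `π` has no `α_0`- or `α_1`-zigzag at any
`k > 0`, and for each `i` with `N = ε_i(π) > 0`, `π` does not attain `min α_i∘π = -N`
during an `α_{i+1}`-stable section at `N`. -/
theorem top_word_path_has_no_decoration {V : Type*} [AddCommGroup V] [Module ℝ V]
    (a0 a1 : V →ₗ[ℝ] ℝ) (v0 v1 : V) (hd : IsAffineSL2 a0 a1 v0 v1)
    (Λ : V) (hΛ0 : ∃ m : ℕ, a0 Λ = m) (hΛ1 : ∃ m : ℕ, a1 Λ = m)
    (t : ℕ) (k : ℕ → ℕ) (i : ℕ → ZMod 2)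
    (hk : ∀ j, j + 1 < t → k (j + 1) < k j) (hkpos : ∀ j, j < t → 0 < k j)
    (hi : ∀ j, j + 1 < t → i (j + 1) = i j + 1)
    (σ : ℕ → (ℝ → V)) (hσt : σ t = fun s => s • Λ)
    (hσ : ∀ j, j < t →
      σ j = (fOp (rootOf a0 a1 (i j)) (corootOf v0 v1 (i j)))^[k j] (σ (j + 1)))
    (hdef : ∀ j, j < t → ∀ m, m < k j →
      1 ≤ phiVal (rootOf a0 a1 (i j))
        ((fOp (rootOf a0 a1 (i j)) (corootOf v0 v1 (i j)))^[m] (σ (j + 1))))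
    (π : ℝ → V) (hπ : π = σ 0) :
    (∀ kk : ℤ, 0 < kk → ¬ HasZigzagAt a0 a1 π kk ∧ ¬ HasZigzagAt a1 a0 π kk) ∧
    (Qval a0 π < 0 →
      ¬ ∃ a b t₀ : ℝ, IsStableSectionAt (fun r => a1 (π r)) (-(Qval a0 π)) a b ∧
        t₀ ∈ Set.Icc a b ∧ a0 (π t₀) = Qval a0 π) ∧
    (Qval a1 π < 0 →
      ¬ ∃ a b t₀ : ℝ, IsStableSectionAt (fun r => a0 (π r)) (-(Qval a1 π)) a b ∧
        t₀ ∈ Set.Icc a b ∧ a1 (π t₀) = Qval a1 π) := by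
  obtain ⟨h00, h11, h01, h10⟩ := hd
  obtain ⟨n0, hn0⟩ := hΛ0
  obtain ⟨n1, hn1⟩ := hΛ1
  have p0 : 0 ≤ a0 Λ := by rw [hn0]; positivity
  have p1 : 0 ≤ a1 Λ := by rw [hn1]; positivity
  have hr0 : rootOf a0 a1 0 = a0 := by simp [rootOf]
  have hr1 : rootOf a0 a1 1 = a1 := by simp [rootOf]
  have hc0 : corootOf v0 v1 0 = v0 := by simp [corootOf]
  have hc1 : corootOf v0 v1 1 = v1 := by simp [corootOf]
  have e11 : (1 : ZMod 2) + 1 = 0 := by decide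
  have base : ∀ z : ZMod 2, Good (a0 Λ + a1 Λ) (fun s => rootOf a0 a1 (z + 1) (σ t s))
      (fun s => rootOf a0 a1 z (σ t s)) 0 := by
    intro z
    rw [hσt]
    simp only [map_smul, smul_eq_mul]
    rcases zmod2_cases z with rfl | rfl
    · rw [zero_add, hr0, hr1, add_comm]; exact good_line p1 p0
    · rw [e11, hr0, hr1]; exact good_line p0 p1
  have pair : ∀ z : ZMod 2, rootOf a0 a1 z (corootOf v0 v1 z) = 2 ∧
      rootOf a0 a1 (z + 1) (corootOf v0 v1 z) = -2 := by
    intro z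
    rcases zmod2_cases z with rfl | rfl
    · rw [zero_add, hr0, hr1, hc0]; exact ⟨h00, h10⟩
    · rw [e11, hr0, hr1, hc1]; exact ⟨h11, h01⟩
  have e2 : ∀ z : ZMod 2, z + 1 + 1 = z := by decide
  have main : ∀ d j, j < t → t - j = d + 1 →
      Good (a0 Λ + a1 Λ) (fun s => rootOf a0 a1 (i j) (σ j s))
        (fun s => rootOf a0 a1 (i j + 1) (σ j s)) (k j) := by
    intro d
    induction d with
    | zero =>
      intro j hj hd
      have hjt : j + 1 = t := by omega
      have g := base (i j)
      rw [← hjt] at g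
      rw [hσ j hj]
      exact g.word_step _ _ _ (pair (i j)).1 (pair (i j)).2 _ (k j)
        (by exact_mod_cast hkpos j hj) (hdef j hj)
    | succ d ih =>
      intro j hj hd
      have hj1 : j + 1 < t := by omega
      have g := ih (j + 1) hj1 (by omega)
      rw [hi j hj1, e2] at g
      rw [hσ j hj]
      exact g.word_step _ _ _ (pair (i j)).1 (pair (i j)).2 _ (k j)
        (by exact_mod_cast hk j hj1) (hdef j hj)
  have fin : ∀ u v N : ℝ, 0 ≤ u → u ≤ v → v ≤ 1 → 0 < N →
      ¬ (a0 (π u) = -N ∧ a1 (π v) = N) ∧ ¬ (a1 (π u) = -N ∧ a0 (π v) = N) := by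
    intro u v N hu huv hv hN
    rw [hπ]
    have key : ∃ κ : ℝ, ∃ z : ZMod 2, Good (a0 Λ + a1 Λ) (fun s => rootOf a0 a1 z (σ 0 s))
        (fun s => rootOf a0 a1 (z + 1) (σ 0 s)) κ := by
      rcases Nat.eq_zero_or_pos t with h | h
      · have g := base 1
        rw [h, e11] at g
        exact ⟨0, 0, by rw [zero_add]; exact g⟩
      · exact ⟨_, _, main (t - 1) 0 h (by omega)⟩
    obtain ⟨κ, z, g⟩ := key
    have f := g.final hu huv hv hN
    rcases zmod2_cases z with rfl | rfl
    · rw [zero_add, hr0, hr1] at f; exact f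
    · rw [e11, hr0, hr1] at f; exact f.symm
  refine ⟨fun kk hkk => ⟨?_, ?_⟩, ?_, ?_⟩
  · rintro ⟨s, v, p, u, h1, h2, h3, hs, ht, -, -⟩
    exact (fin p u kk (hs.1.1.trans h1) h2 hs.1.2.2.1 (by exact_mod_cast hkk)).2
      ⟨ht.1.2.2.2.1, hs.1.2.2.2.2.1⟩
  · rintro ⟨s, v, p, u, h1, h2, h3, hs, ht, -, -⟩
    exact (fin p u kk (hs.1.1.trans h1) h2 hs.1.2.2.1 (by exact_mod_cast hkk)).1
      ⟨ht.1.2.2.2.1, hs.1.2.2.2.2.1⟩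
  · rintro hQ ⟨a, b, t₀, hs, ht₀, e⟩
    exact (fin t₀ b (-(Qval a0 π)) (hs.1.1.trans ht₀.1) ht₀.2 hs.1.2.2.1 (by linarith)).1
      ⟨by rw [e]; ring, hs.1.2.2.2.2.1⟩
  · rintro hQ ⟨a, b, t₀, hs, ht₀, e⟩
    exact (fin t₀ b (-(Qval a1 π)) (hs.1.1.trans ht₀.1) ht₀.2 hs.1.2.2.1 (by linarith)).2
      ⟨by rw [e]; ring, hs.1.2.2.2.2.1⟩

end MVPaper
end
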